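/- Let 1 < p < ∞, m₀ ∈ ℕ, m₁ ∈ ℕ₀, 0 ≤ ℓ < d and a₀ ∈ ℝ. Suppose d/(2p) ≤ m₀ < d/p and m₁ ≤ 2m₀ − d/p, and set a₁ := 2(a₀ − d/(2p)). Then there exists a constant c such that ‖u·v | 𝒦^{m₁}_{a₁,p}(ℝ^d,ℝ^ℓ_*)‖ ≤ c ‖u | 𝒦^{m₀}_{a₀,p}(ℝ^d,ℝ^ℓ_*)‖ · ‖v | 𝒦^{m₀}_{a₀,p}(ℝ^d,ℝ^ℓ_*)‖ holds for all u, v ∈ 𝒦^{m₀}_{a₀,p}(ℝ^d,ℝ^ℓ_*). -/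

import Mathlib

open MeasureTheory Metric Set Filter
open scoped Topology ENNReal NNReal

noncomputable section

/-- `d`-dimensional Euclidean space. -/
abbrev Ed (d : ℕ) : Type := EuclideanSpace ℝ (Fin d)

/-- The finite set of all multi-indices `α : Fin d → ℕ` with `|α| = ∑ i, α i ≤ m`. -/
def multiIdx (d m : ℕ) : Finset (Fin d → ℕ) :=
  (Fintype.piFinset fun _ : Fin d => Finset.range (m + 1)).filter fun α => ∑ i, α i ≤ m

/-- First-order partial derivative in the `i`-th coordinate direction. -/
def pderivI (d : ℕ) (i : Fin d) (f : Ed d → ℝ) : Ed d → ℝ :=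
  fun x => fderiv ℝ f x (EuclideanSpace.single i 1)

/-- Iterated partial derivative `∂^α`. -/
def pderivA (d : ℕ) (α : Fin d → ℕ) (f : Ed d → ℝ) : Ed d → ℝ :=
  ((List.finRange d).foldr (fun i g => (pderivI d i)^[α i] ∘ g) id) f

/-- Smooth compactly supported test functions with support inside `Ω`. -/
def IsTestFun (d : ℕ) (Ω : Set (Ed d)) (φ : Ed d → ℝ) : Prop :=
  ContDiff ℝ (⊤ : ℕ∞) φ ∧ HasCompactSupport φ ∧ tsupport φ ⊆ Ω

/-- `v` is the `α`-th weak (distributional) derivative of `u` on `Ω`. -/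
def HasWeakDerivOn (d : ℕ) (Ω : Set (Ed d)) (α : Fin d → ℕ) (u v : Ed d → ℝ) : Prop :=
  LocallyIntegrableOn u Ω volume ∧ LocallyIntegrableOn v Ω volume ∧
    ∀ φ : Ed d → ℝ, IsTestFun d Ω φ →
      ∫ x in Ω, u x * pderivA d α φ x = (-1 : ℝ) ^ (∑ i, α i) * ∫ x in Ω, v x * φ x

/-- `D` is a family of weak derivatives of `u` on `Ω` for all multi-indices of order `≤ m`. -/
def IsWeakDerivFamily (d : ℕ) (Ω : Set (Ed d)) (m : ℕ) (u : Ed d → ℝ)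
    (D : (Fin d → ℕ) → Ed d → ℝ) : Prop :=
  ∀ α ∈ multiIdx d m, HasWeakDerivOn d Ω α u (D α)

/-- `x ↦ (ρ(x)^(|α|-a) |v(x)|)^p`, the integrand in the Kondratiev norm. -/
def kIntegrand (d : ℕ) (ρ : Ed d → ℝ) (a p : ℝ) (α : Fin d → ℕ) (v : Ed d → ℝ) : Ed d → ℝ :=
  fun x => (ρ x ^ (((∑ i, α i : ℕ) : ℝ) - a) * |v x|) ^ p

/-- The Kondratiev norm computed from a family `D` of weak derivatives. -/
def KnormP (d : ℕ) (Ω : Set (Ed d)) (ρ : Ed d → ℝ) (m : ℕ) (a p : ℝ)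
    (D : (Fin d → ℕ) → Ed d → ℝ) : ℝ :=
  (∑ α ∈ multiIdx d m, ∫ x in Ω, kIntegrand d ρ a p α (D α) x) ^ (1 / p)

/-- `D` witnesses membership of `u` in the Kondratiev space `𝒦^m_{a,p}(Ω, M)`
    (with weight function `ρ`). -/
def KMemData (d : ℕ) (Ω : Set (Ed d)) (ρ : Ed d → ℝ) (m : ℕ) (a p : ℝ)
    (u : Ed d → ℝ) (D : (Fin d → ℕ) → Ed d → ℝ) : Prop :=
  IsWeakDerivFamily d Ω m u D ∧
    ∀ α ∈ multiIdx d m, IntegrableOn (kIntegrand d ρ a p α (D α)) Ω volume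

/-- Membership in the Kondratiev space `𝒦^m_{a,p}(Ω, M)` with weight `ρ`, `p < ∞`. -/
def MemK (d : ℕ) (Ω : Set (Ed d)) (ρ : Ed d → ℝ) (m : ℕ) (a p : ℝ) (u : Ed d → ℝ) : Prop :=
  ∃ D, KMemData d Ω ρ m a p u D

open Classical in
/-- The Kondratiev norm of `u` (computed from a choice of weak derivative family;
    it is a.e. independent of this choice). -/
def Knorm (d : ℕ) (Ω : Set (Ed d)) (ρ : Ed d → ℝ) (m : ℕ) (a p : ℝ) (u : Ed d → ℝ) : ℝ :=
  if h : MemK d Ω ρ m a p u then KnormP d Ω ρ m a p h.choose else 0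

/-- `x ↦ ρ(x)^(|α|-a) v(x)`, the function whose `L_∞` norm enters the norm for `p = ∞`. -/
def kIntegrandInf (d : ℕ) (ρ : Ed d → ℝ) (a : ℝ) (α : Fin d → ℕ) (v : Ed d → ℝ) : Ed d → ℝ :=
  fun x => ρ x ^ (((∑ i, α i : ℕ) : ℝ) - a) * v x

/-- `D` witnesses membership of `u` in `𝒦^m_{a,∞}(Ω, M)`. -/
def KMemDataInf (d : ℕ) (Ω : Set (Ed d)) (ρ : Ed d → ℝ) (m : ℕ) (a : ℝ)
    (u : Ed d → ℝ) (D : (Fin d → ℕ) → Ed d → ℝ) : Prop :=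
  IsWeakDerivFamily d Ω m u D ∧
    ∀ α ∈ multiIdx d m,
      eLpNorm (kIntegrandInf d ρ a α (D α)) ⊤ (volume.restrict Ω) < ⊤

/-- Membership in `𝒦^m_{a,∞}(Ω, M)`. -/
def MemKInf (d : ℕ) (Ω : Set (Ed d)) (ρ : Ed d → ℝ) (m : ℕ) (a : ℝ) (u : Ed d → ℝ) : Prop :=
  ∃ D, KMemDataInf d Ω ρ m a u D

/-- The `𝒦^m_{a,∞}` norm computed from a family `D` of weak derivatives. -/
def KnormInfP (d : ℕ) (Ω : Set (Ed d)) (ρ : Ed d → ℝ) (m : ℕ) (a : ℝ)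
    (D : (Fin d → ℕ) → Ed d → ℝ) : ℝ :=
  ∑ α ∈ multiIdx d m, (eLpNorm (kIntegrandInf d ρ a α (D α)) ⊤ (volume.restrict Ω)).toReal

open Classical in
/-- The `𝒦^m_{a,∞}(Ω, M)` norm of `u`. -/
def KnormInf (d : ℕ) (Ω : Set (Ed d)) (ρ : Ed d → ℝ) (m : ℕ) (a : ℝ) (u : Ed d → ℝ) : ℝ :=
  if h : MemKInf d Ω ρ m a u then KnormInfP d Ω ρ m a h.choose else 0

/-- The subspace `ℝ^ℓ_* = {x : x₁ = ⋯ = x_{d-ℓ} = 0}` of `ℝ^d`. -/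
def RStar (d ℓ : ℕ) : Set (Ed d) := {x | ∀ i : Fin d, (i : ℕ) < d - ℓ → x i = 0}

/-- The weight `ρ(x) = min(1, |x'|)` for the model case `(ℝ^d, ℝ^ℓ_*)`. -/
def rhoModel (d ℓ : ℕ) (x : Ed d) : ℝ :=
  min 1 (Real.sqrt (∑ i ∈ Finset.univ.filter (fun i : Fin d => (i : ℕ) < d - ℓ), (x i) ^ 2))

/-- The model domain `ℝ^d ∖ ℝ^ℓ_*`. -/
def ModelDomain (d ℓ : ℕ) : Set (Ed d) := (RStar d ℓ)ᶜ

/-- Membership in the model Kondratiev space `𝒦^m_{a,p}(ℝ^d, ℝ^ℓ_*)`, `p < ∞`. -/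
def MemKM (d ℓ m : ℕ) (a p : ℝ) (u : Ed d → ℝ) : Prop :=
  MemK d (ModelDomain d ℓ) (rhoModel d ℓ) m a p u

/-- The norm of the model Kondratiev space `𝒦^m_{a,p}(ℝ^d, ℝ^ℓ_*)`, `p < ∞`. -/
def KnormM (d ℓ m : ℕ) (a p : ℝ) (u : Ed d → ℝ) : ℝ :=
  Knorm d (ModelDomain d ℓ) (rhoModel d ℓ) m a p u

/-- Membership in the model Kondratiev space `𝒦^m_{a,∞}(ℝ^d, ℝ^ℓ_*)`. -/
def MemKMInf (d ℓ m : ℕ) (a : ℝ) (u : Ed d → ℝ) : Prop :=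
  MemKInf d (ModelDomain d ℓ) (rhoModel d ℓ) m a u

/-- The norm of the model Kondratiev space `𝒦^m_{a,∞}(ℝ^d, ℝ^ℓ_*)`. -/
def KnormMInf (d ℓ m : ℕ) (a : ℝ) (u : Ed d → ℝ) : ℝ :=
  KnormInf d (ModelDomain d ℓ) (rhoModel d ℓ) m a u

open scoped Convolution in
/-- mollification -/
def moll {d : ℕ} (φ : ContDiffBump (0 : Ed d)) (A : Ed d → ℝ) : Ed d → ℝ :=
  (φ.normed volume) ⋆[ContinuousLinearMap.lsmul ℝ ℝ, volume] A

lemma moll_apply {d : ℕ} (φ : ContDiffBump (0 : Ed d)) (A : Ed d → ℝ) (x : Ed d) :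
    moll φ A x = ∫ y, φ.normed volume y * A (x - y) := by
  simp [moll, convolution]

lemma jensen_prob {X : Type*} [MeasurableSpace X] (ν : Measure X) [IsProbabilityMeasure ν]
    (f : X → ℝ) (hf : AEStronglyMeasurable f ν) (r : ℝ≥0∞) (hr : 1 ≤ r) (hr' : r ≠ ⊤) :
    (∫⁻ x, ‖f x‖ₑ ∂ν) ^ r.toReal ≤ ∫⁻ x, ‖f x‖ₑ ^ r.toReal ∂ν := by
  have h := eLpNorm_le_eLpNorm_of_exponent_le hr hf
  have hr0 : r ≠ 0 := (zero_lt_one.trans_le hr).ne'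
  have hpos : 0 < r.toReal := ENNReal.toReal_pos hr0 hr'
  rw [eLpNorm_one_eq_lintegral_enorm, eLpNorm_eq_lintegral_rpow_enorm_toReal hr0 hr'] at h
  have h2 := ENNReal.rpow_le_rpow h hpos.le
  rwa [← ENNReal.rpow_mul, one_div, inv_mul_cancel₀ hpos.ne', ENNReal.rpow_one] at h2

lemma eLpNorm_moll_le {d : ℕ} (φ : ContDiffBump (0 : Ed d)) (A : Ed d → ℝ)
    (hA : AEStronglyMeasurable A volume) (r : ℝ≥0∞) (hr : 1 ≤ r) (hr' : r ≠ ⊤) :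
    eLpNorm (moll φ A) r volume ≤ eLpNorm A r volume := by
  have hr0 : r ≠ 0 := (zero_lt_one.trans_le hr).ne'
  have hpos : 0 < r.toReal := ENNReal.toReal_pos hr0 hr'
  rw [eLpNorm_eq_lintegral_rpow_enorm_toReal hr0 hr', eLpNorm_eq_lintegral_rpow_enorm_toReal hr0 hr']
  refine ENNReal.rpow_le_rpow ?_ (by positivity)
  have hηm : Measurable (fun y => ‖φ.normed volume y‖ₑ) := φ.continuous_normed.measurable.enorm
  set ν : Measure (Ed d) := volume.withDensity (fun y => ‖φ.normed volume y‖ₑ) with hν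
  have hνp : IsProbabilityMeasure ν := by
    constructor
    rw [hν, withDensity_apply _ MeasurableSet.univ, Measure.restrict_univ]
    have h1 : ∀ y, ‖φ.normed volume y‖ₑ = ENNReal.ofReal (φ.normed volume y) := fun y => by
      rw [Real.enorm_eq_ofReal (φ.nonneg_normed y)]
    simp_rw [h1]
    rw [← ofReal_integral_eq_lintegral_ofReal φ.integrable_normed
      (Eventually.of_forall φ.nonneg_normed), φ.integral_normed, ENNReal.ofReal_one]
  have hac : ν ≪ volume := withDensity_absolutelyContinuous _ _
  have hsub : ∀ x, AEStronglyMeasurable (fun y => A (x - y)) volume := fun x =>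
    hA.comp_quasiMeasurePreserving (Measure.measurePreserving_sub_left volume x).quasiMeasurePreserving
  have hprod : AEStronglyMeasurable (fun z : Ed d × Ed d => A (z.1 - z.2)) (volume.prod volume) :=
    hA.comp_quasiMeasurePreserving (quasiMeasurePreserving_sub volume volume)
  have hprod' : AEStronglyMeasurable (fun z : Ed d × Ed d => A (z.1 - z.2)) (volume.prod ν) :=
    hprod.mono_ac (Measure.AbsolutelyContinuous.rfl.prod hac)
  calc ∫⁻ x, ‖moll φ A x‖ₑ ^ r.toReal
      ≤ ∫⁻ x, (∫⁻ y, ‖A (x - y)‖ₑ ∂ν) ^ r.toReal := by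
        refine lintegral_mono fun x => ENNReal.rpow_le_rpow ?_ hpos.le
        rw [moll_apply, hν, lintegral_withDensity_eq_lintegral_mul₀ hηm.aemeasurable (hsub x).enorm]
        refine (enorm_integral_le_lintegral_enorm _).trans (le_of_eq ?_)
        simp [enorm_mul]
    _ ≤ ∫⁻ x, ∫⁻ y, ‖A (x - y)‖ₑ ^ r.toReal ∂ν :=
        lintegral_mono fun x => jensen_prob ν _ ((hsub x).mono_ac hac) r hr hr'
    _ = ∫⁻ y, (∫⁻ x, ‖A (x - y)‖ₑ ^ r.toReal) ∂ν := by
        rw [lintegral_lintegral_swap]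
        exact (hprod'.enorm.pow_const _)
    _ = ∫⁻ y, (∫⁻ x, ‖A x‖ₑ ^ r.toReal) ∂ν := by
        refine lintegral_congr fun y => ?_
        exact lintegral_sub_right_eq_self (fun x => ‖A x‖ₑ ^ r.toReal) y
    _ = ∫⁻ x, ‖A x‖ₑ ^ r.toReal := by simp

/-- sequence of bumps -/
def bump (d : ℕ) (n : ℕ) : ContDiffBump (0 : Ed d) where
  rIn := 1 / (n + 1 : ℝ) / 2
  rOut := 1 / (n + 1 : ℝ)
  rIn_pos := by positivity
  rIn_lt_rOut := half_lt_self (by positivity)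

lemma bump_tendsto (d : ℕ) : Tendsto (fun n => (bump d n).rOut) atTop (𝓝 0) :=
  tendsto_one_div_add_atTop_nhds_zero_nat

lemma bump_le_one (d n : ℕ) : (bump d n).rOut ≤ 1 := by
  change 1 / (n + 1 : ℝ) ≤ 1
  rw [div_le_one (by positivity)]
  linarith [Nat.cast_nonneg (α := ℝ) n]

lemma moll_sub {d : ℕ} (φ : ContDiffBump (0 : Ed d)) (A B : Ed d → ℝ)
    (hA : LocallyIntegrable A volume) (hB : LocallyIntegrable B volume) :
    moll φ (A - B) = moll φ A - moll φ B := by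
  have key : ∀ D : Ed d → ℝ, LocallyIntegrable D volume → ∀ x,
      Integrable (fun y => φ.normed volume y * D (x - y)) := by
    intro D hD x
    have := (φ.hasCompactSupport_normed (μ := volume)).convolutionExists_left
      (ContinuousLinearMap.lsmul ℝ ℝ) φ.continuous_normed hD x
    simpa [ConvolutionExistsAt] using this
  funext x
  simp only [Pi.sub_apply, moll_apply, mul_sub]
  exact integral_sub (key A hA x) (key B hB x)

lemma moll_add {d : ℕ} (φ : ContDiffBump (0 : Ed d)) (A B : Ed d → ℝ)
    (hA : LocallyIntegrable A volume) (hB : LocallyIntegrable B volume) :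
    moll φ (A + B) = moll φ A + moll φ B := by
  have h := moll_sub φ (A + B) B (hA.add hB) hB
  rw [add_sub_cancel_right] at h
  rw [h, sub_add_cancel]

lemma moll_contDiff {d : ℕ} (φ : ContDiffBump (0 : Ed d)) (A : Ed d → ℝ)
    (hA : LocallyIntegrable A volume) : ContDiff ℝ (⊤ : ℕ∞) (moll φ A) :=
  (φ.hasCompactSupport_normed (μ := volume)).contDiff_convolution_left _ φ.contDiff_normed hA

lemma moll_hasCompactSupport {d : ℕ} (φ : ContDiffBump (0 : Ed d)) (A : Ed d → ℝ)
    (hA : HasCompactSupport A) : HasCompactSupport (moll φ A) :=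
  (φ.hasCompactSupport_normed (μ := volume)).convolution _ hA

lemma moll_tendsto_Lp_cont {d : ℕ} (h : Ed d → ℝ) (hc : Continuous h) (hs : HasCompactSupport h)
    (r : ℝ≥0∞) (hr' : r ≠ ⊤) :
    Tendsto (fun n => eLpNorm (moll (bump d n) h - h) r volume) atTop (𝓝 0) := by
  set S : Set (Ed d) := cthickening 1 (tsupport h) with hS
  have hSc : IsCompact S := IsCompact.cthickening hs
  have hunif := hs.uniformContinuous_of_continuous hc
  have hsupp : ∀ n, Function.support (moll (bump d n) h) ⊆ S := by
    intro n x hx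
    by_contra hxS
    apply hx
    rw [moll_apply]
    refine integral_eq_zero_of_ae (Eventually.of_forall fun y => ?_)
    by_cases hy : y ∈ ball (0 : Ed d) (bump d n).rOut
    · have : h (x - y) = 0 := by
        by_contra hne
        apply hxS
        refine mem_cthickening_of_dist_le x (x - y) 1 _ (subset_tsupport _ hne) ?_
        have : ‖y‖ < (bump d n).rOut := by simpa using hy
        rw [dist_eq_norm]; simpa using this.le.trans (bump_le_one d n)
      simp [this]
    · have : (bump d n).normed volume y = 0 := by
        rw [← Function.notMem_support, ContDiffBump.support_normed_eq]; exact hy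
      simp [this]
  have hsupp2 : Function.support h ⊆ S := (subset_tsupport h).trans (self_subset_cthickening _)
  have hμ : (volume S) ^ (1 / r.toReal) ≠ ⊤ := by
    exact ENNReal.rpow_ne_top_of_nonneg (by positivity) hSc.measure_lt_top.ne
  set M := (volume S) ^ (1 / r.toReal) with hM
  rw [ENNReal.tendsto_nhds_zero]
  intro ε hε
  -- choose c with ofReal c * M ≤ ε
  obtain ⟨c, hc0, hcM⟩ : ∃ c : ℝ, 0 < c ∧ ENNReal.ofReal c * M ≤ ε := by
    have ht : Tendsto (fun c : ℝ => ENNReal.ofReal c * M) (𝓝[>] 0) (𝓝 0) := by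
      have h1 : Tendsto (fun c : ℝ => ENNReal.ofReal c) (𝓝[>] 0) (𝓝 0) := by
        have := (ENNReal.continuous_ofReal.tendsto (0 : ℝ))
        rw [ENNReal.ofReal_zero] at this
        exact this.mono_left nhdsWithin_le_nhds
      simpa using ENNReal.Tendsto.mul_const h1 (Or.inr hμ)
    have h2 := (ENNReal.tendsto_nhds_zero.1 ht ε hε).and self_mem_nhdsWithin
    obtain ⟨c, h3, h4⟩ := h2.exists
    exact ⟨c, h4, h3⟩
  obtain ⟨δ, hδ, hδ2⟩ := Metric.uniformContinuous_iff.1 hunif c hc0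
  filter_upwards [(bump_tendsto d).eventually (gt_mem_nhds hδ)] with n hn
  refine (eLpNorm_sub_le_of_dist_bdd volume hr' hSc.measurableSet hc0.le ?_ (hsupp n) hsupp2).trans hcM
  intro x
  refine ContDiffBump.dist_normed_convolution_le hc.aestronglyMeasurable ?_
  intro y hy
  exact (hδ2 (lt_trans hy hn)).le

lemma moll_tendsto_Lp {d : ℕ} (A : Ed d → ℝ) (r : ℝ≥0∞) (hr : 1 ≤ r) (hr' : r ≠ ⊤)
    (hA : MemLp A r volume) :
    Tendsto (fun n => eLpNorm (moll (bump d n) A - A) r volume) atTop (𝓝 0) := by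
  have hAl : LocallyIntegrable A volume := hA.locallyIntegrable hr
  rw [ENNReal.tendsto_nhds_zero]
  intro ε hε
  have hε3 : ε / 3 ≠ 0 := by simp [hε.ne']
  obtain ⟨h, hs, happ, hc, hh⟩ := hA.exists_hasCompactSupport_eLpNorm_sub_le hr' hε3
  filter_upwards [ENNReal.tendsto_nhds_zero.1 (moll_tendsto_Lp_cont h hc hs r hr') (ε / 3)
    (pos_iff_ne_zero.2 hε3)] with n hn
  have hhl : LocallyIntegrable h volume := hc.locallyIntegrable
  have e : moll (bump d n) A - A = (moll (bump d n) (A - h) + (moll (bump d n) h - h)) - (A - h) := by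
    rw [moll_sub _ _ _ hAl hhl]; abel
  have m1 : AEStronglyMeasurable (moll (bump d n) (A - h)) volume :=
    (moll_contDiff _ _ (hAl.sub hhl)).continuous.aestronglyMeasurable
  have m2 : AEStronglyMeasurable (moll (bump d n) h - h) volume :=
    (moll_contDiff _ _ hhl).continuous.aestronglyMeasurable.sub hc.aestronglyMeasurable
  have m3 : AEStronglyMeasurable (A - h) volume := hA.1.sub hc.aestronglyMeasurable
  rw [e]
  calc _ ≤ eLpNorm (moll (bump d n) (A - h) + (moll (bump d n) h - h)) r volume
          + eLpNorm (A - h) r volume := eLpNorm_sub_le (m1.add m2) m3 hr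
    _ ≤ eLpNorm (moll (bump d n) (A - h)) r volume + eLpNorm (moll (bump d n) h - h) r volume
          + eLpNorm (A - h) r volume := by gcongr; exact eLpNorm_add_le m1 m2 hr
    _ ≤ ε / 3 + ε / 3 + ε / 3 := by
        gcongr
        exact (eLpNorm_moll_le _ _ m3 r hr hr').trans happ
    _ = ε := ENNReal.add_thirds ε

lemma conv_pair {d : ℕ} (A B : Ed d → ℝ) (r s : ℝ≥0∞) [hrs : ENNReal.HolderConjugate r s]
    (hr' : r ≠ ⊤) (hA : MemLp A r volume) (hB : MemLp B s volume) :
    Tendsto (fun n => ∫ x, moll (bump d n) A x * B x) atTop (𝓝 (∫ x, A x * B x)) := by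
  have hr : 1 ≤ r := ENNReal.HolderConjugate.one_le r s
  have hAl : LocallyIntegrable A volume := hA.locallyIntegrable hr
  have hmem : ∀ n, MemLp (moll (bump d n) A) r volume := fun n =>
    ⟨(moll_contDiff _ _ hAl).continuous.aestronglyMeasurable,
      (eLpNorm_moll_le _ _ hA.1 r hr hr').trans_lt hA.2⟩
  have hint : ∀ n, Integrable (fun x => moll (bump d n) A x * B x) := fun n =>
    (hmem n).integrable_mul hB
  have hint0 : Integrable (fun x => A x * B x) := hA.integrable_mul hB
  rw [tendsto_iff_norm_sub_tendsto_zero]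
  have hb : ∀ n, ENNReal.ofReal ‖(∫ x, moll (bump d n) A x * B x) - ∫ x, A x * B x‖ ≤
      eLpNorm (moll (bump d n) A - A) r volume * eLpNorm B s volume := by
    intro n
    rw [← integral_sub (hint n) hint0, ofReal_norm]
    refine (enorm_integral_le_lintegral_enorm _).trans ?_
    rw [← eLpNorm_one_eq_lintegral_enorm]
    have := eLpNorm_smul_le_mul_eLpNorm (p := r) (q := s) (r := 1) hB.1 ((hmem n).1.sub hA.1)
    refine le_trans (le_of_eq ?_) this
    congr 1
    funext x
    simp [sub_mul]
  have ht : Tendsto (fun n => eLpNorm (moll (bump d n) A - A) r volume * eLpNorm B s volume)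
      atTop (𝓝 0) := by
    simpa using ENNReal.Tendsto.mul_const (moll_tendsto_Lp A r hr hr' hA) (Or.inr hB.2.ne)
  have h2 := tendsto_of_tendsto_of_tendsto_of_le_of_le tendsto_const_nhds ht (fun _ => zero_le) hb
  have h3 := (ENNReal.tendsto_toReal (a := 0) (by simp)).comp h2
  refine (h3.congr fun n => ?_)
  simp

/-- first order weak derivative -/
def WD (d : ℕ) (Ω : Set (Ed d)) (i : Fin d) (f g : Ed d → ℝ) : Prop :=
  LocallyIntegrableOn f Ω volume ∧ LocallyIntegrableOn g Ω volume ∧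
    ∀ φ : Ed d → ℝ, IsTestFun d Ω φ → ∫ x, f x * pderivI d i φ x = - ∫ x, g x * φ x

lemma pderivI_contDiff {d : ℕ} (i : Fin d) {f : Ed d → ℝ} (hf : ContDiff ℝ (⊤ : ℕ∞) f) :
    ContDiff ℝ (⊤ : ℕ∞) (pderivI d i f) := by
  unfold pderivI
  exact (hf.fderiv_right (m := (⊤ : ℕ∞)) (by norm_cast)).clm_apply contDiff_const

lemma pderivI_zero_of_notMem {d : ℕ} (i : Fin d) {f : Ed d → ℝ} {x : Ed d} (hx : x ∉ tsupport f) :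
    pderivI d i f x = 0 := by
  unfold pderivI
  have h : fderiv ℝ f x = 0 := by
    by_contra hne
    exact hx (support_fderiv_subset ℝ hne)
  rw [h]; rfl

lemma pderivI_tsupport {d : ℕ} (i : Fin d) (f : Ed d → ℝ) :
    tsupport (pderivI d i f) ⊆ tsupport f := by
  apply closure_minimal _ (isClosed_tsupport f)
  intro x hx
  by_contra h
  exact hx (pderivI_zero_of_notMem i h)

lemma IsTestFun.pderivI {d : ℕ} {Ω : Set (Ed d)} {f : Ed d → ℝ} (hf : IsTestFun d Ω f) (i : Fin d) :
    IsTestFun d Ω (pderivI d i f) :=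
  ⟨pderivI_contDiff i hf.1, hf.2.1.mono' ((subset_tsupport _).trans (pderivI_tsupport i f)),
    (pderivI_tsupport i f).trans hf.2.2⟩

lemma IsTestFun.mul_left {d : ℕ} {Ω : Set (Ed d)} {f g : Ed d → ℝ} (hf : IsTestFun d Ω f)
    (hg : ContDiff ℝ (⊤ : ℕ∞) g) : IsTestFun d Ω (fun x => f x * g x) :=
  ⟨hf.1.mul hg, hf.2.1.mul_right, (tsupport_mul_subset_left).trans hf.2.2⟩

lemma pderivI_mul {d : ℕ} (i : Fin d) {f g : Ed d → ℝ} (hf : ContDiff ℝ (⊤ : ℕ∞) f)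
    (hg : ContDiff ℝ (⊤ : ℕ∞) g) (x : Ed d) :
    pderivI d i (fun y => f y * g y) x = f x * pderivI d i g x + pderivI d i f x * g x := by
  unfold pderivI
  rw [fderiv_fun_mul (hf.differentiable (by simp) x) (hg.differentiable (by simp) x)]
  simp [mul_comm]

/-- test function times locally integrable is integrable -/
lemma IsTestFun.integrable_mul {d : ℕ} {Ω : Set (Ed d)} {φ f : Ed d → ℝ} (hφ : IsTestFun d Ω φ)
    (hf : LocallyIntegrableOn f Ω volume) : Integrable (fun x => f x * φ x) volume := by
  have hK : IsCompact (tsupport φ) := hφ.2.1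
  have h1 : IntegrableOn f (tsupport φ) volume := hf.integrableOn_compact_subset hφ.2.2 hK
  have h2 : IntegrableOn (fun x => f x * φ x) (tsupport φ) volume :=
    h1.mul_continuousOn hφ.1.continuous.continuousOn hK
  rw [integrableOn_iff_integrable_of_support_subset] at h2
  · exact h2
  · intro x hx
    apply subset_tsupport φ
    intro h0
    apply hx
    simp [h0]

lemma IsTestFun.setIntegral {d : ℕ} {Ω : Set (Ed d)} {φ : Ed d → ℝ} (f : Ed d → ℝ)
    (hφ : IsTestFun d Ω φ) : ∫ x in Ω, f x * φ x = ∫ x, f x * φ x := by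
  apply setIntegral_eq_integral_of_forall_compl_eq_zero
  intro x hx
  have : φ x = 0 := by
    by_contra h
    exact hx (hφ.2.2 (subset_tsupport φ h))
  simp [this]

lemma locallyIntegrable_of_univ {d : ℕ} {f : Ed d → ℝ} (h : LocallyIntegrableOn f univ volume) :
    LocallyIntegrable f volume := locallyIntegrableOn_univ.1 h

lemma moll_pderiv {d : ℕ} (φ : ContDiffBump (0 : Ed d)) {i : Fin d} {F G : Ed d → ℝ}
    (h : WD d univ i F G) : pderivI d i (moll φ F) = moll φ G := by
  have hF := locallyIntegrable_of_univ h.1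
  set η : Ed d → ℝ := φ.normed volume with hη
  have hηc : HasCompactSupport η := φ.hasCompactSupport_normed
  have hηs : ContDiff ℝ (⊤ : ℕ∞) η := φ.contDiff_normed
  funext x
  have h1 := hηc.hasFDerivAt_convolution_left (ContinuousLinearMap.lsmul ℝ ℝ)
    (hηs.of_le (by norm_cast)) hF x
  have h2 : pderivI d i (moll φ F) x = ∫ y, pderivI d i η y * F (x - y) := by
    unfold pderivI
    have h3 : fderiv ℝ (moll φ F) x = _ := h1.fderiv
    rw [h3]
    have h4 : ConvolutionExistsAt (fderiv ℝ η) F x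
        ((ContinuousLinearMap.lsmul ℝ ℝ : ℝ →L[ℝ] ℝ →L[ℝ] ℝ).precompL (Ed d)) volume :=
      (hηc.fderiv ℝ).convolutionExists_left _ (hηs.continuous_fderiv (by simp)) hF x
    unfold convolution
    rw [ContinuousLinearMap.integral_apply h4]
    rfl
  set ψ : Ed d → ℝ := fun z => η (x - z) with hψ
  have hψt : IsTestFun d univ ψ := by
    refine ⟨hηs.comp (contDiff_const.sub contDiff_id), ?_, subset_univ _⟩
    exact hηc.comp_homeomorph (Homeomorph.subLeft x)
  have hψd : ∀ z, pderivI d i ψ z = - pderivI d i η (x - z) := by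
    intro z
    unfold pderivI
    have hd : HasFDerivAt ψ ((fderiv ℝ η (x - z)).comp (-(ContinuousLinearMap.id ℝ (Ed d)))) z := by
      apply HasFDerivAt.comp z (g := η)
      · exact (hηs.differentiable (by simp) _).hasFDerivAt
      · simpa using (hasFDerivAt_id z).const_sub x
    rw [hd.fderiv]
    simp
  have h5 := h.2.2 ψ hψt
  rw [h2, moll_apply]
  have e1 : ∫ y, pderivI d i η y * F (x - y) = ∫ z, pderivI d i η (x - z) * F z := by
    rw [← integral_sub_left_eq_self _ volume x]
    simp
  have e2 : ∫ y, η y * G (x - y) = ∫ z, η (x - z) * G z := by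
    rw [← integral_sub_left_eq_self _ volume x]
    simp
  rw [e1, e2]
  simp only [hψd, mul_neg, integral_neg, neg_inj] at h5
  simpa [mul_comm, hψ] using h5

lemma norm_fderiv_le {d : ℕ} (u : Ed d → ℝ) (x : Ed d) :
    ‖fderiv ℝ u x‖ ≤ ∑ i, |pderivI d i u x| := by
  refine ContinuousLinearMap.opNorm_le_bound _ (by positivity) fun v => ?_
  have hv : v = ∑ i, v i • (EuclideanSpace.single i (1 : ℝ) : Ed d) := by
    ext j
    simp [Finset.sum_apply, Pi.single_apply]
  conv_lhs => rw [hv]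
  rw [map_sum, Finset.sum_mul]
  refine (norm_sum_le _ _).trans (Finset.sum_le_sum fun i _ => ?_)
  rw [map_smul, smul_eq_mul, norm_mul, mul_comm]
  gcongr
  · exact le_rfl
  · exact PiLp.norm_apply_le v i

lemma gns_weak (d : ℕ) (hd : 2 ≤ d) (q q' : ℝ≥0) (hq : 1 ≤ q)
    (hqq : (q' : ℝ)⁻¹ = (q : ℝ)⁻¹ - (d : ℝ)⁻¹) :
    ∃ C : ℝ≥0, ∀ (F : Ed d → ℝ) (G : Fin d → Ed d → ℝ), HasCompactSupport F →
      (∀ i, WD d univ i F (G i)) →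
      eLpNorm F q' volume ≤ C * ∑ i, eLpNorm (G i) q volume := by
  refine ⟨eLpNormLESNormFDerivOfEqInnerConst (volume : Measure (Ed d)) q, fun F G hF hG => ?_⟩
  set C := eLpNormLESNormFDerivOfEqInnerConst (volume : Measure (Ed d)) q
  have i0 : Fin d := ⟨0, by omega⟩
  have hFl := locallyIntegrable_of_univ (hG i0).1
  have hq1 : (1 : ℝ≥0∞) ≤ q := by exact_mod_cast hq
  have hn : ∀ n, eLpNorm (moll (bump d n) F) q' volume ≤ C * ∑ i, eLpNorm (G i) q volume := by
    intro n
    have hc := moll_contDiff (bump d n) F hFl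
    refine (eLpNorm_le_eLpNorm_fderiv_of_eq_inner volume
      (hc.of_le (by norm_cast)) (moll_hasCompactSupport (bump d n) F hF) hq
      (by simp; omega) (by simpa using hqq)).trans ?_
    gcongr
    calc eLpNorm (fderiv ℝ (moll (bump d n) F)) q volume
        ≤ eLpNorm (fun x => ∑ i, |pderivI d i (moll (bump d n) F) x|) q volume := by
          refine eLpNorm_mono_real fun x => norm_fderiv_le _ x
      _ = eLpNorm (∑ i, fun x => |moll (bump d n) (G i) x|) q volume := by
          congr 1
          funext x
          simp only [Finset.sum_apply]
          refine Finset.sum_congr rfl fun i _ => ?_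
          rw [moll_pderiv _ (hG i)]
      _ ≤ ∑ i, eLpNorm (fun x => |moll (bump d n) (G i) x|) q volume := by
          refine eLpNorm_sum_le (fun i _ => ?_) hq1
          exact (moll_contDiff _ _ (locallyIntegrable_of_univ (hG i).2.1)).continuous.abs.aestronglyMeasurable
      _ ≤ ∑ i, eLpNorm (G i) q volume := by
          refine Finset.sum_le_sum fun i _ => ?_
          have := eLpNorm_moll_le (bump d n) (G i)
            (locallyIntegrable_of_univ (hG i).2.1).aestronglyMeasurable q hq1 (by simp)
          refine le_trans (le_of_eq ?_) this
          exact eLpNorm_norm (moll (bump d n) (G i))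
  have hae := ContDiffBump.ae_convolution_tendsto_right_of_locallyIntegrable (φ := bump d) (K := 2)
    (l := atTop) (bump_tendsto d) (Eventually.of_forall fun n => by
      change 1 / (n + 1 : ℝ) ≤ 2 * (1 / (n + 1 : ℝ) / 2); linarith) hFl
  have hfat := Lp.eLpNorm_lim_le_liminf_eLpNorm (p := q') (μ := volume) (f := fun n => moll (bump d n) F)
    (fun n => (moll_contDiff (bump d n) F hFl).continuous.aestronglyMeasurable) F hae
  refine hfat.trans ?_
  exact liminf_le_of_le (by isBoundedDefault) fun b hb => by
    obtain ⟨n, hn'⟩ := hb.exists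
    exact hn'.trans (hn n)

lemma exists_cutoff {d : ℕ} {Ω K : Set (Ed d)} (hΩ : IsOpen Ω) (hK : IsCompact K) (hKΩ : K ⊆ Ω) :
    ∃ χ : Ed d → ℝ, IsTestFun d Ω χ ∧ ∀ x ∈ K, χ x = 1 := by
  obtain ⟨K', hK', h1, h2⟩ := exists_compact_between hK hΩ hKΩ
  obtain ⟨f, hf1, hf0, -⟩ := exists_contMDiffMap_one_nhds_of_subset_interior
    (modelWithCornersSelf ℝ (Ed d)) (n := (⊤ : ℕ∞)) hK.isClosed h1
  have hts : tsupport f ⊆ K' := by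
    apply closure_minimal _ hK'.isClosed
    intro x hx
    by_contra h
    exact hx (hf0 x h)
  refine ⟨f, ⟨f.contMDiff.contDiff, ?_, hts.trans h2⟩, fun x hx => hf1.self_of_nhdsSet x hx⟩
  exact hK'.of_isClosed_subset (isClosed_tsupport _) hts

lemma IsTestFun.mono {d : ℕ} {Ω Ω' : Set (Ed d)} {φ : Ed d → ℝ} (h : IsTestFun d Ω φ)
    (hs : Ω ⊆ Ω') : IsTestFun d Ω' φ := ⟨h.1, h.2.1, h.2.2.trans hs⟩

lemma WD.mul_test {d : ℕ} {Ω : Set (Ed d)} {i : Fin d} {f g W : Ed d → ℝ} (h : WD d Ω i f g)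
    (hW : IsTestFun d Ω W) :
    WD d univ i (fun x => W x * f x) (fun x => W x * g x + pderivI d i W x * f x) := by
  have i1 := hW.integrable_mul h.1
  have i2 := hW.integrable_mul h.2.1
  have i3 := (hW.pderivI i).integrable_mul h.1
  simp_rw [mul_comm _ (W _)] at i1 i2
  simp_rw [mul_comm _ (pderivI d i W _)] at i3
  refine ⟨i1.locallyIntegrable.locallyIntegrableOn _,
    (i2.add i3).locallyIntegrable.locallyIntegrableOn _, fun φ hφ => ?_⟩
  have t1 : IsTestFun d Ω (fun x => W x * pderivI d i φ x) := hW.mul_left (pderivI_contDiff i hφ.1)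
  have t2 : IsTestFun d Ω (fun x => pderivI d i W x * φ x) := (hW.pderivI i).mul_left hφ.1
  have t3 : IsTestFun d Ω (fun x => W x * φ x) := hW.mul_left hφ.1
  have key := h.2.2 _ t3
  simp_rw [pderivI_mul i hW.1 hφ.1, mul_add] at key
  rw [integral_add (t1.integrable_mul h.1) (t2.integrable_mul h.1)] at key
  have e1 : ∀ x, W x * f x * pderivI d i φ x = f x * (W x * pderivI d i φ x) := fun x => by ring
  have e2 : ∀ x, (W x * g x + pderivI d i W x * f x) * φ x =
    g x * (W x * φ x) + f x * (pderivI d i W x * φ x) := fun x => by ring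
  simp_rw [e1, e2]
  rw [integral_add (t3.integrable_mul h.2.1) (t2.integrable_mul h.1)]
  linarith

/-- locally in conjugate Lebesgue spaces -/
def LocPair {d : ℕ} (Ω : Set (Ed d)) (f g : Ed d → ℝ) : Prop :=
  ∃ r s : ℝ≥0∞, ENNReal.HolderConjugate r s ∧ r ≠ ⊤ ∧ ∀ χ, IsTestFun d Ω χ →
    MemLp (fun x => χ x * f x) r volume ∧ MemLp (fun x => χ x * g x) s volume

lemma LocPair.locallyIntegrableOn {d : ℕ} {Ω : Set (Ed d)} (hΩ : IsOpen Ω) {f g : Ed d → ℝ}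
    (h : LocPair Ω f g) : LocallyIntegrableOn (fun x => f x * g x) Ω volume := by
  obtain ⟨r, s, hrs, -, hm⟩ := h
  rw [locallyIntegrableOn_iff hΩ.isLocallyClosed]
  intro K hKΩ hK
  obtain ⟨χ, hχ, hχ1⟩ := exists_cutoff hΩ hK hKΩ
  have hi : Integrable (fun x => (χ x * f x) * (χ x * g x)) := (hm χ hχ).1.integrable_mul (hm χ hχ).2
  refine hi.integrableOn.congr_fun (fun x hx => ?_) hK.measurableSet
  simp [hχ1 x hx]

lemma LocPair.tendsto {d : ℕ} {Ω : Set (Ed d)} {f g : Ed d → ℝ}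
    (h : LocPair Ω f g) {χ φ : Ed d → ℝ} (hχ : IsTestFun d Ω χ) (hφ : IsTestFun d Ω φ) :
    Tendsto (fun n => ∫ x, moll (bump d n) (fun y => χ y * f y) x * (φ x * g x)) atTop
      (𝓝 (∫ x, (χ x * f x) * (φ x * g x))) := by
  obtain ⟨r, s, hrs, hr, hm⟩ := h
  exact conv_pair _ _ r s hr (hm χ hχ).1 (hm φ hφ).2

lemma WD.mul {d : ℕ} {Ω : Set (Ed d)} (hΩ : IsOpen Ω) {i : Fin d} {f f' g g' : Ed d → ℝ}
    (hf : WD d Ω i f f') (hg : WD d Ω i g g')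
    (h0 : LocPair Ω f g) (h1 : LocPair Ω f' g) (h2 : LocPair Ω f g') :
    WD d Ω i (fun x => f x * g x) (fun x => f' x * g x + f x * g' x) := by
  have l0 := h0.locallyIntegrableOn hΩ
  have l1 := h1.locallyIntegrableOn hΩ
  have l2 := h2.locallyIntegrableOn hΩ
  refine ⟨l0, l1.add l2, fun φ hφ => ?_⟩
  obtain ⟨χ, hχ, hχ1⟩ := exists_cutoff hΩ hφ.2.1 hφ.2.2
  have hF := hf.mul_test hχ
  have hFl := locallyIntegrable_of_univ hF.1
  have la : LocallyIntegrable (fun x => χ x * f' x) volume := by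
    have := (hχ.integrable_mul hf.2.1).locallyIntegrable
    simpa only [mul_comm] using this
  have lb : LocallyIntegrable (fun x => pderivI d i χ x * f x) volume := by
    have := ((hχ.pderivI i).integrable_mul hf.1).locallyIntegrable
    simpa only [mul_comm] using this
  -- smooth identity
  have hsm : ∀ n, (∫ x, moll (bump d n) (fun y => χ y * f y) x * (pderivI d i φ x * g x)) +
      ((∫ x, moll (bump d n) (fun y => χ y * f' y) x * (φ x * g x)) +
      (∫ x, moll (bump d n) (fun y => pderivI d i χ y * f y) x * (φ x * g x))) +
      (∫ x, moll (bump d n) (fun y => χ y * f y) x * (φ x * g' x)) = 0 := by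
    intro n
    set Fn := moll (bump d n) (fun y => χ y * f y) with hFn
    have hFnc : ContDiff ℝ (⊤ : ℕ∞) Fn := moll_contDiff _ _ hFl
    have hd : pderivI d i Fn = moll (bump d n) (fun y => χ y * f' y) +
        moll (bump d n) (fun y => pderivI d i χ y * f y) := by
      rw [hFn, moll_pderiv _ hF, ← moll_add _ _ _ la lb]; rfl
    have t := hg.2.2 _ (hφ.mul_left hFnc)
    simp_rw [pderivI_mul i hφ.1 hFnc, mul_add] at t
    have ca := moll_contDiff (bump d n) _ la
    have cb := moll_contDiff (bump d n) _ lb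
    have t1 := (hφ.mul_left ca).integrable_mul hg.1
    have t2 := (hφ.mul_left cb).integrable_mul hg.1
    have t3 := ((hφ.pderivI i).mul_left hFnc).integrable_mul hg.1
    rw [hd] at t
    simp only [Pi.add_apply, mul_add] at t
    have t12 : Integrable (fun x => g x * (φ x * moll (bump d n) (fun y => χ y * f' y) x) +
        g x * (φ x * moll (bump d n) (fun y => pderivI d i χ y * f y) x)) := t1.add t2
    rw [integral_add t12 t3, integral_add t1 t2] at t
    have e : ∀ a b c : Ed d → ℝ, ∫ x, a x * (b x * c x) = ∫ x, c x * (b x * a x) := by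
      intro a b c; congr 1; funext x; ring
    rw [e _ (pderivI d i φ) g, e _ φ g, e _ φ g, e _ φ g']
    linarith
  have T1 := h0.tendsto hχ (hφ.pderivI i)
  have T2 := h1.tendsto hχ hφ
  have T3 := h0.tendsto (hχ.pderivI i) hφ
  have T4 := h2.tendsto hχ hφ
  have T := (T1.add (T2.add T3)).add T4
  have hlim := tendsto_nhds_unique T ((tendsto_const_nhds (x := (0 : ℝ))).congr fun n => (hsm n).symm)
  have hχφ : ∀ x, χ x * φ x = φ x := by
    intro x
    by_cases hx : x ∈ tsupport φ
    · rw [hχ1 x hx, one_mul]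
    · rw [image_eq_zero_of_notMem_tsupport hx, mul_zero]
  have hχφ' : ∀ x, χ x * pderivI d i φ x = pderivI d i φ x := by
    intro x
    by_cases hx : x ∈ tsupport φ
    · rw [hχ1 x hx, one_mul]
    · rw [pderivI_zero_of_notMem i hx, mul_zero]
  have hz : ∀ x, pderivI d i χ x * φ x = 0 := by
    intro x
    by_cases hx : φ x = 0
    · rw [hx, mul_zero]
    · have ho : Function.support φ ∈ 𝓝 x := (hφ.1.continuous.isOpen_support).mem_nhds hx
      have he : χ =ᶠ[𝓝 x] fun _ => 1 := by
        filter_upwards [ho] with y hy using hχ1 y (subset_tsupport φ hy)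
      have : pderivI d i χ x = 0 := by
        unfold pderivI
        rw [he.fderiv_eq]; simp
      rw [this, zero_mul]
  have e1 : ∀ x, χ x * f x * (pderivI d i φ x * g x) = f x * g x * pderivI d i φ x := fun x => by
    calc _ = f x * g x * (χ x * pderivI d i φ x) := by ring
      _ = _ := by rw [hχφ']
  have e2 : ∀ x, χ x * f' x * (φ x * g x) = f' x * g x * φ x := fun x => by
    calc _ = f' x * g x * (χ x * φ x) := by ring
      _ = _ := by rw [hχφ]
  have e3 : ∀ x, pderivI d i χ x * f x * (φ x * g x) = 0 := fun x => by
    calc _ = f x * g x * (pderivI d i χ x * φ x) := by ring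
      _ = _ := by rw [hz, mul_zero]
  have e4 : ∀ x, χ x * f x * (φ x * g' x) = f x * g' x * φ x := fun x => by
    calc _ = f x * g' x * (χ x * φ x) := by ring
      _ = _ := by rw [hχφ]
  simp_rw [e1, e2, e3, e4] at hlim
  simp_rw [add_mul]
  rw [integral_add (hφ.integrable_mul l1) (hφ.integrable_mul l2)]
  simp only [integral_zero, add_zero] at hlim
  linarith

lemma WD.add {d : ℕ} {Ω : Set (Ed d)} {i : Fin d} {f f' g g' : Ed d → ℝ}
    (hf : WD d Ω i f f') (hg : WD d Ω i g g') : WD d Ω i (fun x => f x + g x) (fun x => f' x + g' x) := by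
  refine ⟨hf.1.add hg.1, hf.2.1.add hg.2.1, fun φ hφ => ?_⟩
  simp_rw [add_mul]
  rw [integral_add ((hφ.pderivI i).integrable_mul hf.1) ((hφ.pderivI i).integrable_mul hg.1),
    integral_add (hφ.integrable_mul hf.2.1) (hφ.integrable_mul hg.2.1), hf.2.2 φ hφ, hg.2.2 φ hφ]
  ring

lemma WD.zero {d : ℕ} {Ω : Set (Ed d)} {i : Fin d} : WD d Ω i (fun _ => 0) (fun _ => 0) := by
  refine ⟨locallyIntegrableOn_zero, locallyIntegrableOn_zero, fun φ hφ => ?_⟩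
  simp

lemma weak_unique {d : ℕ} {Ω : Set (Ed d)} (hΩ : IsOpen Ω) {α : Fin d → ℕ} {u f g : Ed d → ℝ}
    (hf : HasWeakDerivOn d Ω α u f) (hg : HasWeakDerivOn d Ω α u g) :
    ∀ᵐ x ∂(volume.restrict Ω), f x = g x := by
  have h := hΩ.ae_eq_zero_of_integral_contDiff_smul_eq_zero (μ := volume) (f := fun x => f x - g x)
    (hf.2.1.sub hg.2.1) (fun φ h1 h2 h3 => by
      have hφ : IsTestFun d Ω φ := ⟨h1, h2, h3⟩
      have k := (hf.2.2 φ hφ).symm.trans (hg.2.2 φ hφ)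
      have k2 := mul_left_cancel₀ (by positivity) k
      rw [hφ.setIntegral, hφ.setIntegral] at k2
      have : ∀ x, φ x • (f x - g x) = f x * φ x - g x * φ x := fun x => by simp; ring
      simp_rw [this]
      rw [integral_sub (hφ.integrable_mul hf.2.1) (hφ.integrable_mul hg.2.1), k2, sub_self])
  rw [ae_restrict_iff' hΩ.measurableSet]
  filter_upwards [h] with x hx hxΩ
  linarith [hx hxΩ]

lemma pderivI_comm {d : ℕ} (i j : Fin d) {f : Ed d → ℝ} (hf : ContDiff ℝ (⊤ : ℕ∞) f) :
    pderivI d i (pderivI d j f) = pderivI d j (pderivI d i f) := by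
  funext x
  have hd : DifferentiableAt ℝ (fderiv ℝ f) x :=
    ((hf.fderiv_right (m := 1) (by norm_cast)).differentiable (by simp)) x
  have key : ∀ a b : Fin d, pderivI d a (pderivI d b f) x =
      fderiv ℝ (fderiv ℝ f) x (EuclideanSpace.single a 1) (EuclideanSpace.single b 1) := by
    intro a b
    unfold pderivI
    rw [fderiv_clm_apply hd (differentiableAt_const _)]
    simp
  rw [key, key]
  have hs : IsSymmSndFDerivAt ℝ f x := (hf.contDiffAt).isSymmSndFDerivAt (by simp; norm_cast)
  exact hs _ _

/-- partial derivatives along a list -/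
def pdL {d : ℕ} (l : List (Fin d)) (α : Fin d → ℕ) (f : Ed d → ℝ) : Ed d → ℝ :=
  (l.foldr (fun i g => (pderivI d i)^[α i] ∘ g) id) f

lemma iter_contDiff {d : ℕ} (i : Fin d) (n : ℕ) {f : Ed d → ℝ} (hf : ContDiff ℝ (⊤ : ℕ∞) f) :
    ContDiff ℝ (⊤ : ℕ∞) ((pderivI d i)^[n] f) := by
  induction n with
  | zero => exact hf
  | succ n ih => rw [Function.iterate_succ_apply']; exact pderivI_contDiff i ih

lemma iter_comm {d : ℕ} (i j : Fin d) (n : ℕ) {f : Ed d → ℝ} (hf : ContDiff ℝ (⊤ : ℕ∞) f) :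
    pderivI d i ((pderivI d j)^[n] f) = (pderivI d j)^[n] (pderivI d i f) := by
  induction n with
  | zero => rfl
  | succ n ih =>
    rw [Function.iterate_succ_apply', Function.iterate_succ_apply', ← ih,
      pderivI_comm i j (iter_contDiff j n hf)]

lemma pdL_contDiff {d : ℕ} (l : List (Fin d)) (α : Fin d → ℕ) {f : Ed d → ℝ}
    (hf : ContDiff ℝ (⊤ : ℕ∞) f) : ContDiff ℝ (⊤ : ℕ∞) (pdL l α f) := by
  induction l with
  | nil => exact hf
  | cons j l ih => exact iter_contDiff j (α j) ih

lemma pdL_comm {d : ℕ} (l : List (Fin d)) (α : Fin d → ℕ) (i : Fin d) {f : Ed d → ℝ}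
    (hf : ContDiff ℝ (⊤ : ℕ∞) f) : pderivI d i (pdL l α f) = pdL l α (pderivI d i f) := by
  induction l with
  | nil => rfl
  | cons j l ih =>
    change pderivI d i ((pderivI d j)^[α j] (pdL l α f)) = (pderivI d j)^[α j] (pdL l α (pderivI d i f))
    rw [iter_comm i j _ (pdL_contDiff l α hf), ih]

lemma pdL_notMem {d : ℕ} (l : List (Fin d)) (α : Fin d → ℕ) (i : Fin d) (hi : i ∉ l) (f : Ed d → ℝ) :
    pdL l (α + Pi.single i 1) f = pdL l α f := by
  induction l with
  | nil => rfl
  | cons j l ih =>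
    change (pderivI d j)^[(α + Pi.single i 1 : Fin d → ℕ) j] (pdL l (α + Pi.single i 1) f) = (pderivI d j)^[α j] (pdL l α f)
    rw [List.mem_cons, not_or] at hi
    rw [ih hi.2]
    simp [Pi.single_apply, Ne.symm hi.1]

lemma pdL_mem {d : ℕ} (l : List (Fin d)) (hl : l.Nodup) (α : Fin d → ℕ) (i : Fin d) (hi : i ∈ l)
    {f : Ed d → ℝ} (hf : ContDiff ℝ (⊤ : ℕ∞) f) :
    pdL l (α + Pi.single i 1) f = pdL l α (pderivI d i f) := by
  induction l with
  | nil => simp at hi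
  | cons j l ih =>
    change (pderivI d j)^[(α + Pi.single i 1 : Fin d → ℕ) j] (pdL l (α + Pi.single i 1) f) =
      (pderivI d j)^[α j] (pdL l α (pderivI d i f))
    rw [List.nodup_cons] at hl
    by_cases hij : i = j
    · subst hij
      rw [pdL_notMem l α i hl.1, ← pdL_comm l α i hf]
      simp
    · have : i ∈ l := by simpa [hij] using hi
      rw [ih hl.2 this]
      simp [Pi.single_apply, Ne.symm hij]

lemma pderivA_add_single {d : ℕ} (α : Fin d → ℕ) (i : Fin d) {f : Ed d → ℝ}
    (hf : ContDiff ℝ (⊤ : ℕ∞) f) :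
    pderivA d (α + Pi.single i 1) f = pderivA d α (pderivI d i f) :=
  pdL_mem (List.finRange d) (List.nodup_finRange d) α i (List.mem_finRange i) hf

lemma pderivA_zero {d : ℕ} (f : Ed d → ℝ) : pderivA d 0 f = f := by
  change pdL (List.finRange d) 0 f = f
  induction (List.finRange d) with
  | nil => rfl
  | cons j l ih => change (pderivI d j)^[0] (pdL l 0 f) = f; simpa using ih

lemma sum_add_single {d : ℕ} (α : Fin d → ℕ) (i : Fin d) :
    ∑ j, (α + Pi.single i 1 : Fin d → ℕ) j = (∑ j, α j) + 1 := by
  simp [Finset.sum_add_distrib]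

lemma wd_of_has {d : ℕ} {Ω : Set (Ed d)} {α : Fin d → ℕ} {i : Fin d} {u f g : Ed d → ℝ}
    (hf : HasWeakDerivOn d Ω α u f) (hg : HasWeakDerivOn d Ω (α + Pi.single i 1) u g) :
    WD d Ω i f g := by
  refine ⟨hf.2.1, hg.2.1, fun φ hφ => ?_⟩
  have h1 := hf.2.2 _ (hφ.pderivI i)
  have h2 := hg.2.2 _ hφ
  rw [pderivA_add_single α i hφ.1, h1, (hφ.pderivI i).setIntegral, hφ.setIntegral, sum_add_single,
    pow_succ, mul_assoc] at h2
  have := mul_left_cancel₀ (by positivity) h2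
  linarith

lemma has_of_wd {d : ℕ} {Ω : Set (Ed d)} {α : Fin d → ℕ} {i : Fin d} {u f g : Ed d → ℝ}
    (hf : HasWeakDerivOn d Ω α u f) (hg : WD d Ω i f g) :
    HasWeakDerivOn d Ω (α + Pi.single i 1) u g := by
  refine ⟨hf.1, hg.2.1, fun φ hφ => ?_⟩
  rw [pderivA_add_single α i hφ.1, hf.2.2 _ (hφ.pderivI i), (hφ.pderivI i).setIntegral,
    hφ.setIntegral, hg.2.2 φ hφ, sum_add_single, pow_succ]
  ring

/-- partial sum of squares -/
def SA {d : ℕ} (A : Finset (Fin d)) (x : Ed d) : ℝ := ∑ i ∈ A, (x i) ^ 2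

lemma SA_nonneg {d : ℕ} (A : Finset (Fin d)) (x : Ed d) : 0 ≤ SA A x :=
  Finset.sum_nonneg fun _ _ => sq_nonneg _

lemma SA_contDiff {d : ℕ} (A : Finset (Fin d)) : ContDiff ℝ (⊤ : ℕ∞) (SA A) := by
  unfold SA
  refine ContDiff.sum fun i _ => ContDiff.pow ?_ 2
  exact (EuclideanSpace.proj i : Ed d →L[ℝ] ℝ).contDiff

lemma pderivI_comp {d : ℕ} (i : Fin d) {f : Ed d → ℝ} {h : ℝ → ℝ} {h' : ℝ} {x : Ed d}
    (hf : ContDiff ℝ (⊤ : ℕ∞) f) (hh : HasDerivAt h h' (f x)) :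
    pderivI d i (fun y => h (f y)) x = h' * pderivI d i f x := by
  unfold pderivI
  have := hh.comp_hasFDerivAt x (hf.differentiable (by simp) x).hasFDerivAt
  have h2 : fderiv ℝ (fun y => h (f y)) x = _ := this.fderiv
  rw [h2]; simp

lemma pderivI_SA_le {d : ℕ} (A : Finset (Fin d)) (i : Fin d) (x : Ed d) :
    |pderivI d i (SA A) x| ≤ 2 * √(SA A x) := by
  have h : HasFDerivAt (SA A) (∑ j ∈ A, (2 * x j) • (EuclideanSpace.proj j : Ed d →L[ℝ] ℝ)) x := by
    unfold SA
    refine HasFDerivAt.fun_sum fun j _ => ?_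
    have := ((EuclideanSpace.proj j : Ed d →L[ℝ] ℝ).hasFDerivAt (x := x)).pow 2
    simpa using this
  unfold pderivI
  rw [h.fderiv]
  have e : (∑ j ∈ A, (2 * x j) • (EuclideanSpace.proj j : Ed d →L[ℝ] ℝ)) (EuclideanSpace.single i 1) =
      if i ∈ A then 2 * x i else 0 := by
    simp [ContinuousLinearMap.sum_apply, Pi.single_apply]
  rw [e]
  split_ifs with hi
  · rw [abs_mul, abs_two]
    gcongr
    apply Real.abs_le_sqrt
    exact Finset.single_le_sum (f := fun j => (x j) ^ 2) (fun j _ => sq_nonneg _) hi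
  · simp

/-- relevant coordinates -/
def AA (d ℓ : ℕ) : Finset (Fin d) := Finset.univ.filter (fun i : Fin d => (i : ℕ) < d - ℓ)

/-- smooth weight squared -/
def tau (d ℓ : ℕ) (x : Ed d) : ℝ := SA (AA d ℓ) x / (1 + SA (AA d ℓ) x)

/-- decay at infinity -/
def zet (d : ℕ) (x : Ed d) : ℝ := 1 / (1 + SA Finset.univ x)

lemma mem_model_iff {d ℓ : ℕ} (x : Ed d) : x ∈ ModelDomain d ℓ ↔ 0 < SA (AA d ℓ) x := by
  rw [(SA_nonneg _ x).lt_iff_ne', ModelDomain, mem_compl_iff, not_iff_not]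
  unfold SA
  rw [Finset.sum_eq_zero_iff_of_nonneg (fun _ _ => sq_nonneg _)]
  simp [RStar, AA]

lemma model_open (d ℓ : ℕ) : IsOpen (ModelDomain d ℓ) := by
  have : ModelDomain d ℓ = {x | 0 < SA (AA d ℓ) x} := by ext x; exact mem_model_iff x
  rw [this]
  exact isOpen_lt continuous_const (SA_contDiff _).continuous

lemma tau_contDiff (d ℓ : ℕ) : ContDiff ℝ (⊤ : ℕ∞) (tau d ℓ) := by
  unfold tau
  refine (SA_contDiff _).div (contDiff_const.add (SA_contDiff _)) fun x => ?_
  have := SA_nonneg (AA d ℓ) x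
  positivity

lemma zet_contDiff (d : ℕ) : ContDiff ℝ (⊤ : ℕ∞) (zet d) := by
  unfold zet
  refine contDiff_const.div (contDiff_const.add (SA_contDiff _)) fun x => ?_
  have := SA_nonneg (d := d) Finset.univ x
  positivity

lemma tau_nonneg {d ℓ : ℕ} (x : Ed d) : 0 ≤ tau d ℓ x := by
  have := SA_nonneg (AA d ℓ) x
  unfold tau; positivity

lemma tau_pos {d ℓ : ℕ} {x : Ed d} (hx : x ∈ ModelDomain d ℓ) : 0 < tau d ℓ x := by
  have := (mem_model_iff x).1 hx
  unfold tau; positivity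

lemma tau_le_one {d ℓ : ℕ} (x : Ed d) : tau d ℓ x ≤ 1 := by
  have := SA_nonneg (AA d ℓ) x
  unfold tau; rw [div_le_one (by positivity)]; linarith

lemma zet_pos {d : ℕ} (x : Ed d) : 0 < zet d x := by
  have := SA_nonneg (d := d) Finset.univ x
  unfold zet; positivity

lemma rho_sq {d ℓ : ℕ} (x : Ed d) : rhoModel d ℓ x ^ 2 = min 1 (SA (AA d ℓ) x) := by
  have h0 := SA_nonneg (AA d ℓ) x
  change (min 1 (√(SA (AA d ℓ) x))) ^ 2 = _
  rcases le_total 1 (SA (AA d ℓ) x) with h | h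
  · rw [min_eq_left h, min_eq_left (by rwa [Real.one_le_sqrt]), one_pow]
  · rw [min_eq_right h, min_eq_right (by rwa [Real.sqrt_le_one]), Real.sq_sqrt h0]

lemma tau_le_rho {d ℓ : ℕ} (x : Ed d) : tau d ℓ x ≤ rhoModel d ℓ x ^ 2 := by
  have h0 := SA_nonneg (AA d ℓ) x
  rw [rho_sq]
  refine le_min (tau_le_one x) ?_
  unfold tau
  exact div_le_self h0 (by linarith)

lemma rho_le_tau {d ℓ : ℕ} (x : Ed d) : rhoModel d ℓ x ^ 2 ≤ 2 * tau d ℓ x := by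
  have h0 := SA_nonneg (AA d ℓ) x
  rw [rho_sq]
  unfold tau
  rw [← mul_div_assoc, le_div_iff₀ (by positivity)]
  rcases le_total 1 (SA (AA d ℓ) x) with h | h
  · rw [min_eq_left h]; linarith
  · rw [min_eq_right h]; nlinarith

lemma pderivI_tau_le {d ℓ : ℕ} (i : Fin d) (x : Ed d) :
    |pderivI d i (tau d ℓ) x| ≤ 2 * √(tau d ℓ x) := by
  have h0 := SA_nonneg (AA d ℓ) x
  have hd : HasDerivAt (fun t : ℝ => t / (1 + t)) (1 / (1 + SA (AA d ℓ) x) ^ 2) (SA (AA d ℓ) x) := by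
    have := (hasDerivAt_id (SA (AA d ℓ) x)).div ((hasDerivAt_id (SA (AA d ℓ) x)).const_add 1)
      (by simp only [id]; positivity)
    convert this using 1 <;> first | rfl | (simp; done)
  have h1 : pderivI d i (tau d ℓ) x = _ := pderivI_comp i (SA_contDiff (AA d ℓ)) hd
  rw [h1, abs_mul, abs_of_nonneg (by positivity)]
  have h2 := pderivI_SA_le (AA d ℓ) i x
  set t := SA (AA d ℓ) x
  have h3 : √(tau d ℓ x) = √t / √(1 + t) := Real.sqrt_div h0 _
  rw [h3]
  have h4 : √(1 + t) ≤ (1 + t) ^ 2 := by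
    rw [Real.sqrt_le_left (by positivity)]
    have : (1:ℝ) ≤ 1 + t := by linarith
    calc 1 + t = (1 + t) ^ 1 := by ring
      _ ≤ (1 + t) ^ 4 := pow_le_pow_right₀ this (by norm_num)
      _ = _ := by ring
  have h5 : 0 < √(1 + t) := by positivity
  calc 1 / (1 + t) ^ 2 * |pderivI d i (SA (AA d ℓ)) x| ≤ 1 / √(1 + t) * (2 * √t) := by gcongr
    _ = _ := by ring

lemma pderivI_zet_le {d : ℕ} (i : Fin d) (x : Ed d) :
    |pderivI d i (zet d) x| ≤ zet d x := by
  have h0 := SA_nonneg (d := d) Finset.univ x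
  have hd : HasDerivAt (fun t : ℝ => 1 / (1 + t)) (-1 / (1 + SA Finset.univ x) ^ 2)
      (SA Finset.univ x) := by
    have := (hasDerivAt_const (SA Finset.univ x) (1:ℝ)).div ((hasDerivAt_id (SA Finset.univ x)).const_add 1)
      (by simp only [id]; positivity)
    convert this using 1 <;> first | rfl | (simp; done)
  have h1 : pderivI d i (fun y => (fun t : ℝ => 1 / (1 + t)) (SA Finset.univ y)) x = _ :=
    pderivI_comp (h := fun t : ℝ => 1 / (1 + t)) (f := SA Finset.univ) i
      (SA_contDiff Finset.univ) hd
  change pderivI d i (zet d) x = _ at h1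
  have h2 := pderivI_SA_le Finset.univ i x
  rw [h1, abs_mul]
  unfold zet
  set t := SA (d := d) Finset.univ x
  rw [abs_div, abs_neg, abs_one, abs_of_nonneg (by positivity : 0 ≤ (1 + t) ^ 2)]
  have h4 : 2 * √t ≤ 1 + t := by nlinarith [sq_nonneg (√t - 1), Real.sq_sqrt h0]
  calc 1 / (1 + t) ^ 2 * |pderivI d i (SA Finset.univ) x| ≤ 1 / (1 + t) ^ 2 * (1 + t) := by
        gcongr; exact h2.trans h4
    _ = _ := by field_simp

/-- cutoff variable -/
def ome (d ℓ : ℕ) (x : Ed d) : ℝ := tau d ℓ x * zet d x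

lemma ome_contDiff (d ℓ : ℕ) : ContDiff ℝ (⊤ : ℕ∞) (ome d ℓ) := (tau_contDiff d ℓ).mul (zet_contDiff d)

lemma ome_pos {d ℓ : ℕ} {x : Ed d} (hx : x ∈ ModelDomain d ℓ) : 0 < ome d ℓ x :=
  mul_pos (tau_pos hx) (zet_pos x)

lemma pderivI_ome_le {d ℓ : ℕ} (i : Fin d) {x : Ed d} (hx : x ∈ ModelDomain d ℓ) :
    |pderivI d i (ome d ℓ) x| ≤ 3 * (ome d ℓ x / √(tau d ℓ x)) := by
  have ht := tau_pos hx
  have hz := zet_pos x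
  have h1 : pderivI d i (ome d ℓ) x = _ := pderivI_mul i (tau_contDiff d ℓ) (zet_contDiff d) x
  have h2 := pderivI_tau_le (ℓ := ℓ) i x
  have h3 := pderivI_zet_le i x
  have hs : 0 < √(tau d ℓ x) := by positivity
  have hs1 : √(tau d ℓ x) ≤ 1 := by rw [Real.sqrt_le_one]; exact tau_le_one x
  have e : ome d ℓ x / √(tau d ℓ x) = √(tau d ℓ x) * zet d x := by
    unfold ome
    rw [mul_div_right_comm, Real.div_sqrt]
  rw [h1, e]
  refine (abs_add_le _ _).trans ?_
  rw [abs_mul, abs_mul, abs_of_pos ht, abs_of_pos hz]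
  have h4 : tau d ℓ x ≤ √(tau d ℓ x) := by
    nlinarith [Real.sq_sqrt ht.le]
  calc tau d ℓ x * |pderivI d i (zet d) x| + |pderivI d i (tau d ℓ) x| * zet d x
      ≤ √(tau d ℓ x) * zet d x + 2 * √(tau d ℓ x) * zet d x := by gcongr
    _ = _ := by ring

/-- one-dimensional cutoff -/
def thet (y : ℝ) : ℝ := Real.smoothTransition (y - 1)

lemma thet_contDiff : ContDiff ℝ (⊤ : ℕ∞) thet :=
  Real.smoothTransition.contDiff.comp (contDiff_id.sub contDiff_const)

lemma thet_bound : ∃ K : ℝ, 0 ≤ K ∧ ∀ y, |y * deriv thet y| ≤ K := by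
  have hc : Continuous (fun y => |y * deriv thet y|) :=
    (continuous_id.mul (thet_contDiff.continuous_deriv (by simp))).abs
  obtain ⟨K, hK⟩ := (isCompact_Icc (a := (1:ℝ)) (b := 2)).bddAbove_image hc.continuousOn
  refine ⟨max K 0, le_max_right _ _, fun y => ?_⟩
  by_cases hy : y ∈ Icc (1:ℝ) 2
  · exact (hK (mem_image_of_mem _ hy)).trans (le_max_left _ _)
  · have hz : deriv thet y = 0 := by
      rw [mem_Icc, not_and_or, not_le, not_le] at hy
      rcases hy with hy | hy
      · have : thet =ᶠ[𝓝 y] fun _ => 0 := by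
          filter_upwards [gt_mem_nhds hy] with z hz
          exact Real.smoothTransition.zero_of_nonpos (by linarith)
        rw [this.deriv_eq]; simp
      · have : thet =ᶠ[𝓝 y] fun _ => 1 := by
          filter_upwards [lt_mem_nhds hy] with z hz
          exact Real.smoothTransition.one_of_one_le (by linarith)
        rw [this.deriv_eq]; simp
    simp [hz]

/-- weight -/
def TT (d ℓ : ℕ) (s : ℝ) (x : Ed d) : ℝ := tau d ℓ x ^ (s / 2)

/-- truncated weight -/
def WW (d ℓ : ℕ) (s : ℝ) (n : ℕ) (x : Ed d) : ℝ := TT d ℓ s x * thet (n * ome d ℓ x)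

lemma TT_nonneg {d ℓ : ℕ} (s : ℝ) (x : Ed d) : 0 ≤ TT d ℓ s x := Real.rpow_nonneg (tau_nonneg x) _

lemma TT_pos {d ℓ : ℕ} (s : ℝ) {x : Ed d} (hx : x ∈ ModelDomain d ℓ) : 0 < TT d ℓ s x :=
  Real.rpow_pos_of_pos (tau_pos hx) _

lemma TT_add {d ℓ : ℕ} (s t : ℝ) {x : Ed d} (hx : x ∈ ModelDomain d ℓ) :
    TT d ℓ (s + t) x = TT d ℓ s x * TT d ℓ t x := by
  unfold TT; rw [add_div, Real.rpow_add (tau_pos hx)]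

lemma TT_measurable {d ℓ : ℕ} (s : ℝ) : Measurable (TT d ℓ s) :=
  (tau_contDiff d ℓ).continuous.measurable.pow_const _

lemma thet_comp_contDiff (d ℓ n : ℕ) : ContDiff ℝ (⊤ : ℕ∞) (fun x => thet (n * ome d ℓ x)) :=
  thet_contDiff.comp (contDiff_const.mul (ome_contDiff d ℓ))

lemma TT_contDiffAt {d ℓ : ℕ} (s : ℝ) {x : Ed d} (hx : x ∈ ModelDomain d ℓ) :
    ContDiffAt ℝ (⊤ : ℕ∞) (TT d ℓ s) x :=
  (tau_contDiff d ℓ).contDiffAt.rpow_const_of_ne (tau_pos hx).ne'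

lemma WW_support {d ℓ : ℕ} (s : ℝ) (n : ℕ) : tsupport (WW d ℓ s n) ⊆ {x | 1 ≤ n * ome d ℓ x} := by
  apply closure_minimal
  · intro x hx
    by_contra h
    apply hx
    simp only [mem_setOf_eq, not_le] at h
    have : thet (n * ome d ℓ x) = 0 := Real.smoothTransition.zero_of_nonpos (by linarith)
    simp [WW, this]
  · exact isClosed_le continuous_const (continuous_const.mul (ome_contDiff d ℓ).continuous)

lemma WW_set_sub {d ℓ : ℕ} (n : ℕ) : {x | 1 ≤ n * ome d ℓ x} ⊆ ModelDomain d ℓ := by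
  intro x hx
  by_contra h
  rw [mem_model_iff, not_lt] at h
  have h0 : SA (AA d ℓ) x = 0 := le_antisymm h (SA_nonneg _ _)
  have : ome d ℓ x = 0 := by simp [ome, tau, h0]
  simp only [mem_setOf_eq, this] at hx
  norm_num at hx

lemma WW_test (d ℓ : ℕ) (s : ℝ) (n : ℕ) : IsTestFun d (ModelDomain d ℓ) (WW d ℓ s n) := by
  refine ⟨?_, ?_, (WW_support s n).trans (WW_set_sub n)⟩
  · rw [contDiff_iff_contDiffAt]
    intro x
    by_cases hx : x ∈ ModelDomain d ℓ
    · exact (TT_contDiffAt s hx).mul (thet_comp_contDiff d ℓ n).contDiffAt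
    · have hx' : x ∉ tsupport (WW d ℓ s n) := fun h => hx (WW_set_sub n (WW_support s n h))
      have : WW d ℓ s n =ᶠ[𝓝 x] fun _ => 0 := notMem_tsupport_iff_eventuallyEq.1 hx'
      exact contDiffAt_const.congr_of_eventuallyEq this
  · refine (isCompact_closedBall (0 : Ed d) (√n)).of_isClosed_subset (isClosed_tsupport _) ?_
    intro x hx
    have h1 : 1 ≤ n * ome d ℓ x := WW_support s n hx
    have hz := zet_pos x
    have h2 : 1 ≤ n * zet d x := h1.trans (by
      have := tau_le_one (ℓ := ℓ) x
      unfold ome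
      gcongr
      nlinarith)
    have h0 := SA_nonneg (d := d) Finset.univ x
    unfold zet at h2
    rw [mul_one_div, le_div_iff₀ (by positivity)] at h2
    rw [mem_closedBall_zero_iff, EuclideanSpace.norm_eq]
    apply Real.sqrt_le_sqrt
    have : ∑ i, ‖x i‖ ^ 2 = SA Finset.univ x := by simp [SA]
    rw [this]; linarith

lemma WW_le {d ℓ : ℕ} (s : ℝ) (n : ℕ) (x : Ed d) : |WW d ℓ s n x| ≤ TT d ℓ s x := by
  unfold WW
  rw [abs_mul, abs_of_nonneg (TT_nonneg s x)]
  refine mul_le_of_le_one_right (TT_nonneg s x) ?_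
  unfold thet
  rw [abs_of_nonneg (Real.smoothTransition.nonneg _)]
  exact Real.smoothTransition.le_one _

lemma WW_tendsto {d ℓ : ℕ} (s : ℝ) {x : Ed d} (hx : x ∈ ModelDomain d ℓ) :
    Tendsto (fun n => WW d ℓ s n x) atTop (𝓝 (TT d ℓ s x)) := by
  apply tendsto_const_nhds.congr'
  have h : Tendsto (fun n : ℕ => (n : ℝ) * ome d ℓ x) atTop atTop :=
    tendsto_natCast_atTop_atTop.atTop_mul_const (ome_pos hx)
  filter_upwards [h.eventually_ge_atTop 2] with n hn
  have : thet (n * ome d ℓ x) = 1 := Real.smoothTransition.one_of_one_le (by linarith)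
  simp [WW, this]

lemma WW_deriv_bound (d ℓ : ℕ) (s : ℝ) : ∃ C : ℝ, 0 ≤ C ∧ ∀ n i, ∀ x ∈ ModelDomain d ℓ,
    |pderivI d i (WW d ℓ s n) x| ≤ C * TT d ℓ (s - 1) x := by
  obtain ⟨K, hK0, hK⟩ := thet_bound
  refine ⟨3 * K + |s|, by positivity, fun n i x hx => ?_⟩
  have ht := tau_pos hx
  have hs : 0 < √(tau d ℓ x) := by positivity
  have e1 : pderivI d i (WW d ℓ s n) x = TT d ℓ s x * pderivI d i (fun y => thet (n * ome d ℓ y)) x +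
      pderivI d i (TT d ℓ s) x * thet (n * ome d ℓ x) := by
    unfold WW pderivI
    rw [fderiv_fun_mul ((TT_contDiffAt s hx).differentiableAt (by simp))
      ((thet_comp_contDiff d ℓ n).differentiable (by simp) x)]
    simp [mul_comm]
  have e2 : pderivI d i (fun y => thet (n * ome d ℓ y)) x =
      deriv thet (n * ome d ℓ x) * n * pderivI d i (ome d ℓ) x := by
    refine pderivI_comp i (h := fun t => thet (n * t)) (ome_contDiff d ℓ) ?_
    have h1 := (thet_contDiff.differentiable (by simp) (n * ome d ℓ x)).hasDerivAt
    have h2 : HasDerivAt (fun t : ℝ => (n : ℝ) * t) n (ome d ℓ x) := by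
      simpa using (hasDerivAt_id (ome d ℓ x)).const_mul (n : ℝ)
    exact h1.comp _ h2
  have e3 : pderivI d i (TT d ℓ s) x = (s / 2 * tau d ℓ x ^ (s / 2 - 1)) * pderivI d i (tau d ℓ) x := by
    refine pderivI_comp i (h := fun t => t ^ (s / 2)) (tau_contDiff d ℓ) ?_
    exact Real.hasDerivAt_rpow_const (Or.inl ht.ne')
  have e4 : TT d ℓ (s - 1) x = TT d ℓ s x / √(tau d ℓ x) := by
    unfold TT
    rw [Real.sqrt_eq_rpow, ← Real.rpow_sub ht]; congr 1; ring
  have e5 : tau d ℓ x ^ (s / 2 - 1) * √(tau d ℓ x) = TT d ℓ (s - 1) x := by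
    unfold TT
    rw [Real.sqrt_eq_rpow, ← Real.rpow_add ht]; congr 1; ring
  have b2 : |pderivI d i (fun y => thet (n * ome d ℓ y)) x| ≤ 3 * K / √(tau d ℓ x) := by
    rw [e2, abs_mul, abs_mul]
    have h := hK (n * ome d ℓ x)
    rw [abs_mul, abs_mul, abs_of_pos (ome_pos hx)] at h
    calc _ ≤ |deriv thet (n * ome d ℓ x)| * |(n : ℝ)| * (3 * (ome d ℓ x / √(tau d ℓ x))) := by
          gcongr; exact pderivI_ome_le i hx
      _ = 3 * (|(n : ℝ)| * ome d ℓ x * |deriv thet (n * ome d ℓ x)|) / √(tau d ℓ x) := by ring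
      _ ≤ _ := by gcongr
  have b3 : |pderivI d i (TT d ℓ s) x| ≤ |s| * TT d ℓ (s - 1) x := by
    rw [e3, abs_mul, abs_mul, abs_of_pos (Real.rpow_pos_of_pos ht _), ← e5, abs_div, abs_two]
    calc _ ≤ |s| / 2 * tau d ℓ x ^ (s / 2 - 1) * (2 * √(tau d ℓ x)) := by
          gcongr; exact pderivI_tau_le i x
      _ = _ := by ring
  have b4 : |thet (n * ome d ℓ x)| ≤ 1 := by
    unfold thet
    rw [abs_of_nonneg (Real.smoothTransition.nonneg _)]
    exact Real.smoothTransition.le_one _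
  rw [e1]
  refine (abs_add_le _ _).trans ?_
  rw [abs_mul, abs_mul, abs_of_nonneg (TT_nonneg s x)]
  have hT := TT_nonneg (d := d) (ℓ := ℓ) s x
  have hT' := TT_nonneg (d := d) (ℓ := ℓ) (s - 1) x
  calc _ ≤ TT d ℓ s x * (3 * K / √(tau d ℓ x)) + |s| * TT d ℓ (s - 1) x * 1 := by gcongr
    _ = 3 * K * (TT d ℓ s x / √(tau d ℓ x)) + |s| * TT d ℓ (s - 1) x := by ring
    _ = _ := by rw [← e4]; ring

/-- the restricted measure -/
abbrev muO (d ℓ : ℕ) : Measure (Ed d) := volume.restrict (ModelDomain d ℓ)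

lemma ae_mem_model (d ℓ : ℕ) : ∀ᵐ x ∂(muO d ℓ), x ∈ ModelDomain d ℓ :=
  ae_restrict_mem (model_open d ℓ).measurableSet

lemma WD.aesm {d ℓ : ℕ} {i : Fin d} {f g : Ed d → ℝ} (h : WD d (ModelDomain d ℓ) i f g) :
    AEStronglyMeasurable f (muO d ℓ) ∧ AEStronglyMeasurable g (muO d ℓ) :=
  ⟨h.1.aestronglyMeasurable, h.2.1.aestronglyMeasurable⟩

lemma wsob (d ℓ : ℕ) (hd : 2 ≤ d) (q q' : ℝ≥0) (hq : 1 ≤ q)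
    (hqq : (q' : ℝ)⁻¹ = (q : ℝ)⁻¹ - (d : ℝ)⁻¹) (s : ℝ) :
    ∃ C : ℝ≥0, ∀ (f : Ed d → ℝ) (g : Fin d → Ed d → ℝ),
      (∀ i, WD d (ModelDomain d ℓ) i f (g i)) →
      eLpNorm (fun x => TT d ℓ s x * f x) q' (muO d ℓ) ≤
        C * (eLpNorm (fun x => TT d ℓ (s - 1) x * f x) q (muO d ℓ)
          + ∑ i, eLpNorm (fun x => TT d ℓ s x * g i x) q (muO d ℓ)) := by
  obtain ⟨C, hC⟩ := gns_weak d hd q q' hq hqq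
  obtain ⟨K, hK0, hK⟩ := WW_deriv_bound d ℓ s
  refine ⟨C * (1 + d * K.toNNReal), fun f g hfg => ?_⟩
  have i0 : Fin d := ⟨0, by omega⟩
  have hq1 : (1 : ℝ≥0∞) ≤ q := by exact_mod_cast hq
  have hfm := (hfg i0).aesm.1
  have hgm := fun i => (hfg i).aesm.2
  set X := eLpNorm (fun x => TT d ℓ (s - 1) x * f x) q (muO d ℓ)
  set Y := ∑ i, eLpNorm (fun x => TT d ℓ s x * g i x) q (muO d ℓ)
  have hn : ∀ n, eLpNorm (fun x => WW d ℓ s n x * f x) q' (muO d ℓ) ≤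
      C * (1 + d * K.toNNReal) * (X + Y) := by
    intro n
    have hW := WW_test d ℓ s n
    have h1 := hC (fun x => WW d ℓ s n x * f x) _ (hW.2.1.mul_right)
      (fun i => (hfg i).mul_test hW)
    refine (eLpNorm_mono_measure _ Measure.restrict_le_self).trans (h1.trans ?_)
    rw [mul_assoc]
    gcongr
    have h2 : ∀ i, eLpNorm (fun x => WW d ℓ s n x * g i x + pderivI d i (WW d ℓ s n) x * f x) q volume
        ≤ eLpNorm (fun x => TT d ℓ s x * g i x) q (muO d ℓ) + K.toNNReal * X := by
      intro i
      have hsup : Function.support (fun x => WW d ℓ s n x * g i x + pderivI d i (WW d ℓ s n) x * f x)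
          ⊆ ModelDomain d ℓ := by
        intro x hx
        by_contra hxn
        apply hx
        have hxt : x ∉ tsupport (WW d ℓ s n) := fun h => hxn (hW.2.2 h)
        simp [image_eq_zero_of_notMem_tsupport hxt, pderivI_zero_of_notMem i hxt]
      rw [← eLpNorm_restrict_eq_of_support_subset hsup]
      refine (eLpNorm_add_le (f := fun x => WW d ℓ s n x * g i x)
        (g := fun x => pderivI d i (WW d ℓ s n) x * f x) ?_ ?_ hq1).trans ?_
      · exact hW.1.continuous.aestronglyMeasurable.mul (hgm i)
      · exact (hW.pderivI i).1.continuous.aestronglyMeasurable.mul hfm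
      gcongr
      · refine eLpNorm_mono fun x => ?_
        rw [norm_mul, norm_mul]
        gcongr
        rw [Real.norm_eq_abs, Real.norm_eq_abs, abs_of_nonneg (TT_nonneg s x)]
        exact WW_le s n x
      · refine eLpNorm_le_nnreal_smul_eLpNorm_of_ae_le_mul ?_ q
        filter_upwards [ae_mem_model d ℓ] with x hx
        rw [← NNReal.coe_le_coe]
        simp only [NNReal.coe_mul, coe_nnnorm, Real.coe_toNNReal _ hK0, norm_mul, Real.norm_eq_abs]
        rw [abs_of_nonneg (TT_nonneg (s - 1) x), ← mul_assoc]
        gcongr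
        exact hK n i x hx
    calc _ ≤ ∑ i, (eLpNorm (fun x => TT d ℓ s x * g i x) q (muO d ℓ) + K.toNNReal * X) :=
          Finset.sum_le_sum fun i _ => h2 i
      _ = Y + d * K.toNNReal * X := by
          rw [Finset.sum_add_distrib]; simp [Y, mul_assoc]
      _ ≤ (1 + d * K.toNNReal) * Y + (1 + d * K.toNNReal) * X := by
          gcongr
          · exact le_mul_of_one_le_left (by positivity) (by simp)
          · simp
      _ = _ := by ring
  have hfat := Lp.eLpNorm_lim_le_liminf_eLpNorm (p := q') (μ := muO d ℓ)
    (f := fun n x => WW d ℓ s n x * f x)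
    (fun n => (WW_test d ℓ s n).1.continuous.aestronglyMeasurable.mul hfm)
    (fun x => TT d ℓ s x * f x) (by
      filter_upwards [ae_mem_model d ℓ] with x hx
      exact (WW_tendsto s hx).mul_const _)
  refine hfat.trans ?_
  push_cast
  exact liminf_le_of_le (by isBoundedDefault) fun b hb => by
    obtain ⟨n, hn'⟩ := hb.exists
    exact hn'.trans (hn n)

/-- Sobolev exponent -/
def pk (d : ℕ) (p : ℝ) (k : ℕ) : ℝ≥0 := ((p⁻¹ - k / d)⁻¹).toNNReal

/-- a family of weak derivatives with weighted bounds -/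
def Fam (d ℓ m : ℕ) (a p : ℝ) (D : (Fin d → ℕ) → Ed d → ℝ) (N : ℝ≥0∞) : Prop :=
  (∀ α, ∑ j, α j ≤ m → LocallyIntegrableOn (D α) (ModelDomain d ℓ) volume) ∧
  (∀ α i, ∑ j, α j + 1 ≤ m → WD d (ModelDomain d ℓ) i (D α) (D (α + Pi.single i 1))) ∧
  (∀ α, ∑ j, α j ≤ m →
    eLpNorm (fun x => TT d ℓ (((∑ j, α j : ℕ) : ℝ) - a) x * D α x) p.toNNReal (muO d ℓ) ≤ N)

lemma pk_pos {d m : ℕ} {p : ℝ} (hp : 1 < p) (hm : (m : ℝ) < d / p) (hd : 2 ≤ d) {k : ℕ} (hk : k ≤ m) :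
    0 < p⁻¹ - k / d ∧ ((pk d p k : ℝ)⁻¹ = p⁻¹ - k / d) := by
  have hd0 : (0:ℝ) < d := by positivity
  have h1 : (0:ℝ) < p⁻¹ - k / d := by
    have h2 : (k:ℝ) < d / p := lt_of_le_of_lt (by exact_mod_cast hk) hm
    rw [sub_pos, div_lt_iff₀ hd0]
    rw [div_eq_mul_inv] at h2; linarith
  refine ⟨h1, ?_⟩
  unfold pk
  rw [Real.coe_toNNReal _ (by positivity), inv_inv]

lemma pk_ge {d m : ℕ} {p : ℝ} (hp : 1 < p) (hm : (m : ℝ) < d / p) (hd : 2 ≤ d) {k : ℕ} (hk : k ≤ m) :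
    p ≤ pk d p k := by
  obtain ⟨h1, h2⟩ := pk_pos hp hm hd hk
  have h3 : (pk d p k : ℝ) = (p⁻¹ - k / d)⁻¹ := by rw [← h2, inv_inv]
  rw [h3, le_inv_comm₀ (by positivity) h1]
  have : (0:ℝ) ≤ k / d := by positivity
  linarith

lemma sob_iter (d ℓ m : ℕ) (a p : ℝ) (hp : 1 < p) (hd : 2 ≤ d) (hm : (m : ℝ) < d / p) (k : ℕ) :
    ∀ n : ℕ, ∃ C : ℝ≥0, ∀ D N, Fam d ℓ m a p D N → ∀ α : Fin d → ℕ, ∑ j, α j = n → n + k ≤ m →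
      eLpNorm (fun x => TT d ℓ ((n : ℝ) - a + k) x * D α x) (pk d p k) (muO d ℓ) ≤ C * N := by
  induction k with
  | zero =>
    intro n
    refine ⟨1, fun D N hF α hα hn => ?_⟩
    have := hF.2.2 α (by omega)
    rw [hα] at this
    simpa [pk] using this
  | succ k ih =>
    intro n
    by_cases hnk : n + (k + 1) ≤ m
    swap
    · exact ⟨0, fun D N hF α hα hn => absurd hn hnk⟩
    obtain ⟨C0, hC0⟩ := ih n
    obtain ⟨C1, hC1⟩ := ih (n + 1)
    have hk := pk_pos hp hm hd (k := k) (by omega)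
    have hk1 := pk_pos hp hm hd (k := k + 1) (by omega)
    have hge := pk_ge hp hm hd (k := k) (by omega)
    obtain ⟨C2, hC2⟩ := wsob d ℓ hd (pk d p k) (pk d p (k + 1))
      (by rw [← NNReal.coe_le_coe]; push_cast; linarith)
      (by rw [hk.2, hk1.2]; push_cast; ring) ((n : ℝ) - a + (k + 1 : ℕ))
    refine ⟨C2 * (C0 + d * C1), fun D N hF α hα hn => ?_⟩
    refine (hC2 (D α) (fun i => D (α + Pi.single i 1)) (fun i => hF.2.1 α i (by omega))).trans ?_
    push_cast
    rw [mul_assoc]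
    gcongr
    rw [add_mul]
    gcongr
    · have := hC0 D N hF α hα (by omega)
      have e : ((n : ℝ) - a + (k + 1)) - 1 = n - a + k := by ring
      rw [e]; exact this
    · calc _ ≤ ∑ i : Fin d, (C1 * N : ℝ≥0∞) := by
            refine Finset.sum_le_sum fun i _ => ?_
            have := hC1 D N hF (α + Pi.single i 1) (by rw [sum_add_single, hα]) (by omega)
            have e : ((n + 1 : ℕ) : ℝ) - a + k = (n : ℝ) - a + (k + 1) := by push_cast; ring
            rw [e] at this; exact this
        _ = _ := by simp [mul_assoc]

lemma lint_le {d : ℕ} {μ : Measure (Ed d)} {q : ℝ≥0} (hq : 0 < q) {A : Ed d → ℝ} {X : ℝ≥0∞}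
    (hA : eLpNorm A q μ ≤ X) : ∫⁻ x, ‖A x‖ₑ ^ (q : ℝ) ∂μ ≤ X ^ (q : ℝ) := by
  rw [eLpNorm_eq_lintegral_rpow_enorm_toReal (by positivity) (by simp)] at hA
  simp only [ENNReal.coe_toReal, one_div] at hA
  rwa [ENNReal.rpow_inv_le_iff (by positivity)] at hA

lemma holder3 {d : ℕ} {μ : Measure (Ed d)} {p q r : ℝ≥0} (hp : 0 < p) (hq : 0 < q) (hr : 0 < r)
    {θ : ℝ} (h0 : 0 ≤ θ) (h1 : θ ≤ 1)
    (hsum : (p : ℝ)⁻¹ = (q : ℝ)⁻¹ + θ * (p : ℝ)⁻¹ + (1 - θ) * (r : ℝ)⁻¹)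
    {h A B B' : Ed d → ℝ} (mA : AEStronglyMeasurable A μ) (mB : AEStronglyMeasurable B μ)
    (mB' : AEStronglyMeasurable B' μ)
    (hh : ∀ᵐ x ∂μ, ‖h x‖ₑ ≤ ‖A x‖ₑ * ‖B x‖ₑ ^ θ * ‖B' x‖ₑ ^ (1 - θ)) {X Y : ℝ≥0∞}
    (hA : eLpNorm A q μ ≤ X) (hB : eLpNorm B p μ ≤ Y) (hB' : eLpNorm B' r μ ≤ Y) :
    eLpNorm h p μ ≤ X * Y := by
  have hp' : (0:ℝ) < p := by exact_mod_cast hp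
  have hq' : (0:ℝ) < q := by exact_mod_cast hq
  have hr' : (0:ℝ) < r := by exact_mod_cast hr
  have h1' : 0 ≤ 1 - θ := by linarith
  rw [eLpNorm_eq_lintegral_rpow_enorm_toReal (by positivity) (by simp)]
  simp only [ENNReal.coe_toReal, one_div]
  rw [ENNReal.rpow_inv_le_iff hp']
  have hH := ENNReal.lintegral_prod_norm_pow_le (μ := μ) (Finset.univ : Finset (Fin 3))
    (f := ![fun x => ‖A x‖ₑ ^ (q : ℝ), fun x => ‖B x‖ₑ ^ (p : ℝ), fun x => ‖B' x‖ₑ ^ (r : ℝ)])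
    (p := ![(p : ℝ) / q, θ, (1 - θ) * (p / r)]) (by
      intro i _
      fin_cases i
      · exact mA.enorm.pow_const _
      · exact mB.enorm.pow_const _
      · exact mB'.enorm.pow_const _) (by
      simp only [Fin.sum_univ_three]
      change (p : ℝ) / q + θ + (1 - θ) * (p / r) = 1
      have h3 : (p : ℝ) * (p : ℝ)⁻¹ = 1 := mul_inv_cancel₀ hp'.ne'
      have h4 := congrArg (fun t => (p : ℝ) * t) hsum
      beta_reduce at h4
      rw [h3] at h4
      have h5 : (p : ℝ) * ((q : ℝ)⁻¹ + θ * (p : ℝ)⁻¹ + (1 - θ) * (r : ℝ)⁻¹) =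
        (p : ℝ) / q + θ * ((p : ℝ) * (p : ℝ)⁻¹) + (1 - θ) * (p / r) := by ring
      rw [h5, h3, mul_one] at h4
      exact h4.symm) (by
      intro i _
      fin_cases i
      · change (0:ℝ) ≤ p / q; positivity
      · exact h0
      · change (0:ℝ) ≤ (1 - θ) * (p / r); positivity)
  simp only [Fin.prod_univ_three] at hH
  change ∫⁻ x, (‖A x‖ₑ ^ (q : ℝ)) ^ ((p : ℝ) / q) * (‖B x‖ₑ ^ (p : ℝ)) ^ θ *
    (‖B' x‖ₑ ^ (r : ℝ)) ^ ((1 - θ) * (p / r)) ∂μ ≤ (∫⁻ x, ‖A x‖ₑ ^ (q : ℝ) ∂μ) ^ ((p : ℝ) / q) *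
    (∫⁻ x, ‖B x‖ₑ ^ (p : ℝ) ∂μ) ^ θ * (∫⁻ x, ‖B' x‖ₑ ^ (r : ℝ) ∂μ) ^ ((1 - θ) * (p / r)) at hH
  have e1 : (q : ℝ) * ((p : ℝ) / q) = p := by field_simp
  have e2 : (r : ℝ) * ((1 - θ) * (p / r)) = (1 - θ) * p := by field_simp
  have e3 : (p : ℝ) * θ = θ * p := by ring
  calc ∫⁻ x, ‖h x‖ₑ ^ (p : ℝ) ∂μ ≤ _ := by
        refine lintegral_mono_ae ?_
        filter_upwards [hh] with x hx
        refine (ENNReal.rpow_le_rpow hx hp'.le).trans_eq ?_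
        rw [ENNReal.mul_rpow_of_nonneg _ _ hp'.le, ENNReal.mul_rpow_of_nonneg _ _ hp'.le,
          ← ENNReal.rpow_mul, ← ENNReal.rpow_mul]
        rw [← e2, ← e3]
        nth_rewrite 1 [← e1]
        rw [ENNReal.rpow_mul, ENNReal.rpow_mul, ENNReal.rpow_mul]
    _ ≤ _ := hH
    _ ≤ (X ^ (q : ℝ)) ^ ((p : ℝ) / q) * (Y ^ (p : ℝ)) ^ θ * (Y ^ (r : ℝ)) ^ ((1 - θ) * (p / r)) := by
        gcongr
        · exact lint_le hq hA
        · exact lint_le hp hB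
        · exact lint_le hr hB'
    _ = (X * Y) ^ (p : ℝ) := by
        rw [← ENNReal.rpow_mul, ← ENNReal.rpow_mul, ← ENNReal.rpow_mul, e1, e2, e3, mul_assoc,
          ← ENNReal.rpow_add_of_nonneg _ _ (by positivity) (by positivity),
          ENNReal.mul_rpow_of_nonneg _ _ hp'.le]
        congr 2; ring

lemma TT_enorm_rpow {d ℓ : ℕ} (s : ℝ) {θ : ℝ} (h : 0 ≤ θ) (x : Ed d) :
    ‖TT d ℓ s x‖ₑ ^ θ = ‖TT d ℓ (s * θ) x‖ₑ := by
  rw [← Real.enorm_rpow_of_nonneg (TT_nonneg s x) h]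
  unfold TT
  rw [← Real.rpow_mul (tau_nonneg x)]
  congr 2; ring

lemma Fam.aesm {d ℓ m : ℕ} {a p : ℝ} {D : (Fin d → ℕ) → Ed d → ℝ} {N : ℝ≥0∞}
    (h : Fam d ℓ m a p D N) {α : Fin d → ℕ} (hα : ∑ j, α j ≤ m) (s : ℝ) :
    AEStronglyMeasurable (fun x => TT d ℓ s x * D α x) (muO d ℓ) :=
  (TT_measurable s).aestronglyMeasurable.mul (h.1 α hα).aestronglyMeasurable

lemma prod_bound (d ℓ m₀ m₁ : ℕ) (a₀ p : ℝ) (hp : 1 < p) (hd : 2 ≤ d) (hm : (m₀ : ℝ) < d / p)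
    (hm₁ : (m₁ : ℝ) ≤ 2 * m₀ - d / p) (n k : ℕ) (hnk : n + k ≤ m₁) :
    ∃ C : ℝ≥0, ∀ D E N M, Fam d ℓ m₀ a₀ p D N → Fam d ℓ m₀ a₀ p E M →
      ∀ β γ : Fin d → ℕ, ∑ j, β j = n → ∑ j, γ j = k →
      eLpNorm (fun x => TT d ℓ (((n + k : ℕ) : ℝ) - 2 * (a₀ - d / (2 * p))) x * (D β x * E γ x))
        p.toNNReal (muO d ℓ) ≤ C * N * M := by
  have hd0 : (0:ℝ) < d := by positivity
  have hp0 : 0 < p := by linarith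
  have hlt : m₁ < m₀ := by
    have : (m₁ : ℝ) < m₀ := by linarith
    exact_mod_cast this
  obtain ⟨j, rfl⟩ : ∃ j, m₀ = n + j := ⟨m₀ - n, by omega⟩
  obtain ⟨i, hi⟩ : ∃ i, n + j = k + i := ⟨n + j - k, by omega⟩
  have hi0 : 0 < i := by omega
  have hi' : (0:ℝ) < i := by exact_mod_cast hi0
  obtain ⟨C1, hC1⟩ := sob_iter d ℓ (n + j) a₀ p hp hd hm j n
  obtain ⟨C2, hC2⟩ := sob_iter d ℓ (n + j) a₀ p hp hd hm i k
  have hj := pk_pos hp hm hd (k := j) (by omega)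
  have hii := pk_pos hp hm hd (k := i) (by omega)
  have hjg := pk_ge hp hm hd (k := j) (by omega)
  have hig := pk_ge hp hm hd (k := i) (by omega)
  refine ⟨C1 * (1 + C2), fun D E N M hD hE β γ hβ hγ => ?_⟩
  have hnR : ((n : ℝ) + k) ≤ m₁ := by exact_mod_cast hnk
  have hiR : (n : ℝ) + j = k + i := by exact_mod_cast hi
  push_cast at hm hm₁
  set θ : ℝ := 1 - (d / p - j) / i with hθ
  have hdp : (j : ℝ) ≤ d / p := by
    have : (0:ℝ) ≤ n := by positivity
    linarith
  have hcast : ((p.toNNReal : ℝ≥0) : ℝ) = p := Real.coe_toNNReal _ hp0.le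
  have hmain := holder3 (μ := muO d ℓ) (p := p.toNNReal) (q := pk d p j) (r := pk d p i) (θ := θ)
    (h := fun x => TT d ℓ (((n + k : ℕ) : ℝ) - 2 * (a₀ - d / (2 * p))) x * (D β x * E γ x))
    (A := fun x => TT d ℓ ((n : ℝ) - a₀ + j) x * D β x)
    (B := fun x => TT d ℓ ((k : ℝ) - a₀) x * E γ x)
    (B' := fun x => TT d ℓ ((k : ℝ) - a₀ + i) x * E γ x)
    (X := C1 * N) (Y := (1 + C2) * M) (by rw [← NNReal.coe_lt_coe, hcast]; exact hp0)
    (by rw [← NNReal.coe_lt_coe]; push_cast; linarith)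
    (by rw [← NNReal.coe_lt_coe]; push_cast; linarith)
    (by rw [hθ, sub_nonneg, div_le_one hi']; linarith)
    (by rw [hθ, sub_le_self_iff]; exact div_nonneg (by linarith) hi'.le)
    (by rw [hcast, hj.2, hii.2, hθ]; field_simp; ring)
    (hD.aesm (by omega) _) (hE.aesm (by omega) _) (hE.aesm (by omega) _)
    (by
      filter_upwards [ae_mem_model d ℓ] with x hx
      have h0 : 0 ≤ θ := by rw [hθ, sub_nonneg, div_le_one hi']; linarith
      have h1 : 0 ≤ 1 - θ := by rw [hθ, sub_sub_cancel]; exact div_nonneg (by linarith) hi'.le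
      have e0 : ((n + k : ℕ) : ℝ) - 2 * (a₀ - d / (2 * p)) =
          ((n : ℝ) - a₀ + j) + (((k : ℝ) - a₀) * θ + ((k : ℝ) - a₀ + i) * (1 - θ)) := by
        have : (i : ℝ) * (1 - θ) = d / p - j := by rw [hθ]; field_simp; ring
        have e' : (d : ℝ) / (2 * p) = (d / p) / 2 := by field_simp
        rw [e']; push_cast
        linear_combination -this
      rw [e0, TT_add ((n : ℝ) - a₀ + j) _ hx, TT_add (((k : ℝ) - a₀) * θ) _ hx]
      simp only [enorm_mul]
      rw [ENNReal.mul_rpow_of_nonneg _ _ h0, ENNReal.mul_rpow_of_nonneg _ _ h1,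
        TT_enorm_rpow _ h0, TT_enorm_rpow _ h1]
      have e1 : ‖E γ x‖ₑ = ‖E γ x‖ₑ ^ θ * ‖E γ x‖ₑ ^ (1 - θ) := by
        rw [← ENNReal.rpow_add_of_nonneg _ _ h0 h1]; simp
      refine le_of_eq ?_
      nth_rewrite 1 [e1]
      ring)
    (hC1 D N hD β hβ (by omega))
    ((by have := hE.2.2 γ (by omega)
         rw [hγ] at this
         exact this.trans (le_mul_of_one_le_left (by positivity) (by simp))))
    ((hC2 E M hE γ hγ (by omega)).trans (by gcongr; simp))
  refine hmain.trans_eq ?_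
  push_cast; ring

lemma test_memLp {d ℓ m : ℕ} {a p : ℝ} (hp : 1 < p) (hd : 2 ≤ d) (hm : (m : ℝ) < d / p)
    {D : (Fin d → ℕ) → Ed d → ℝ} {N : ℝ≥0∞} (hN : N ≠ ⊤) (hD : Fam d ℓ m a p D N)
    (α : Fin d → ℕ) (k : ℕ) (hk : ∑ j, α j + k ≤ m) {χ : Ed d → ℝ}
    (hχ : IsTestFun d (ModelDomain d ℓ) χ) :
    MemLp (fun x => χ x * D α x) (pk d p k) volume := by
  obtain ⟨C, hC⟩ := sob_iter d ℓ m a p hp hd hm k (∑ j, α j)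
  have hb := hC D N hD α rfl hk
  set s : ℝ := ((∑ j, α j : ℕ) : ℝ) - a + k
  have hcont : ContinuousOn (fun x => χ x * TT d ℓ (-s) x) (tsupport χ) :=
    hχ.1.continuous.continuousOn.mul
      fun x hx => ((TT_contDiffAt (-s) (hχ.2.2 hx)).continuousAt).continuousWithinAt
  obtain ⟨K, hK⟩ := (IsCompact.exists_bound_of_continuousOn hχ.2.1 hcont)
  have hint := hχ.integrable_mul (hD.1 α (by omega))
  simp_rw [mul_comm _ (χ _)] at hint
  refine ⟨hint.aestronglyMeasurable, ?_⟩
  have hsup : Function.support (fun x => χ x * D α x) ⊆ ModelDomain d ℓ := by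
    intro x hx
    apply hχ.2.2
    apply subset_tsupport
    intro h0
    apply hx
    simp [h0]
  rw [← eLpNorm_restrict_eq_of_support_subset hsup]
  have hle := eLpNorm_le_nnreal_smul_eLpNorm_of_ae_le_mul (μ := muO d ℓ) (f := fun x => χ x * D α x)
    (g := fun x => TT d ℓ s x * D α x) (c := K.toNNReal) (by
      filter_upwards [ae_mem_model d ℓ] with x hx
      rw [← NNReal.coe_le_coe]
      simp only [NNReal.coe_mul, coe_nnnorm]
      by_cases hxs : x ∈ tsupport χ
      · have h1 := hK x hxs
        have h2 : TT d ℓ (-s) x * TT d ℓ s x = 1 := by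
          rw [← TT_add _ _ hx]; simp [TT]
        calc ‖χ x * D α x‖ = ‖χ x * TT d ℓ (-s) x‖ * ‖TT d ℓ s x * D α x‖ := by
              rw [← norm_mul]; congr 1
              linear_combination (-(χ x * D α x)) * h2
          _ ≤ _ := by gcongr; exact h1.trans (Real.le_coe_toNNReal K)
      · rw [image_eq_zero_of_notMem_tsupport hxs]; simp; positivity) (pk d p k)
  refine hle.trans_lt ?_
  refine ENNReal.mul_lt_top (by simp) (hb.trans_lt (ENNReal.mul_lt_top (by simp) hN.lt_top))

lemma fam_locPair {d ℓ m₀ m₁ : ℕ} {a₀ p : ℝ} (hp : 1 < p) (hd : 2 ≤ d) (hm : (m₀ : ℝ) < d / p)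
    (hm₁ : (m₁ : ℝ) ≤ 2 * m₀ - d / p) {D E : (Fin d → ℕ) → Ed d → ℝ} {N M : ℝ≥0∞}
    (hN : N ≠ ⊤) (hM : M ≠ ⊤) (hD : Fam d ℓ m₀ a₀ p D N) (hE : Fam d ℓ m₀ a₀ p E M)
    (β γ : Fin d → ℕ) (hβγ : ∑ j, β j + ∑ j, γ j ≤ m₁) :
    LocPair (ModelDomain d ℓ) (D β) (E γ) := by
  have hd0 : (0:ℝ) < d := by positivity
  have hp0 : 0 < p := by linarith
  have hlt : m₁ < m₀ := by
    have : (m₁ : ℝ) < m₀ := by linarith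
    exact_mod_cast this
  obtain ⟨j, hj⟩ : ∃ j, m₀ = ∑ j, β j + j := ⟨m₀ - ∑ j, β j, by omega⟩
  obtain ⟨i, hi⟩ : ∃ i, m₀ = ∑ j, γ j + i := ⟨m₀ - ∑ j, γ j, by omega⟩
  have hjp := pk_pos hp hm hd (k := j) (by omega)
  have hip := pk_pos hp hm hd (k := i) (by omega)
  have hjg := pk_ge hp hm hd (k := j) (by omega)
  have hig := pk_ge hp hm hd (k := i) (by omega)
  have hr1 : 1 < pk d p j := by rw [← NNReal.coe_lt_coe]; push_cast; linarith
  have hc := NNReal.HolderConjugate.conjExponent hr1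
  refine ⟨pk d p j, NNReal.conjExponent (pk d p j), hc.coe_ennreal, by simp, fun χ hχ =>
    ⟨test_memLp hp hd hm hN hD β j hj.ge hχ, ?_⟩⟩
  refine (test_memLp hp hd hm hM hE γ i hi.ge hχ).mono_exponent_of_measure_support_ne_top
    (s := tsupport χ) (fun x hx => by simp [image_eq_zero_of_notMem_tsupport hx])
    hχ.2.1.measure_lt_top.ne ?_
  rw [ENNReal.coe_le_coe, ← NNReal.coe_le_coe]
  have hs0 : (0:ℝ) < NNReal.conjExponent (pk d p j) := by exact_mod_cast hc.symm.pos
  rw [← inv_le_inv₀ (by linarith) hs0, hip.2]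
  have h4 : ((pk d p j : ℝ))⁻¹ + ((NNReal.conjExponent (pk d p j) : ℝ≥0) : ℝ)⁻¹ = 1 := by
    exact_mod_cast congrArg (fun t : ℝ≥0 => (t : ℝ)) hc.inv_add_inv_eq_one
  rw [hjp.2] at h4
  have h5 : p⁻¹ ≤ 1 := inv_le_one_of_one_le₀ hp.le
  have h6 : (d : ℝ) / p ≤ i + j := by
    have e1 : (m₀ : ℝ) = ((∑ j, β j : ℕ) : ℝ) + j := by exact_mod_cast hj
    have e2 : (m₀ : ℝ) = ((∑ j, γ j : ℕ) : ℝ) + i := by exact_mod_cast hi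
    have e3 : ((∑ j, β j : ℕ) : ℝ) + ((∑ j, γ j : ℕ) : ℝ) ≤ m₁ := by exact_mod_cast hβγ
    linarith
  have h7 : p⁻¹ ≤ i / d + j / d := by
    rw [← add_div, le_div_iff₀ hd0]
    rw [div_eq_mul_inv] at h6; linarith
  linarith

lemma wd_list {d m : ℕ} {Ω : Set (Ed d)} (hΩ : IsOpen Ω) {D E : (Fin d → ℕ) → Ed d → ℝ}
    (hD : ∀ α i, ∑ j, α j + 1 ≤ m → WD d Ω i (D α) (D (α + Pi.single i 1)))
    (hE : ∀ α i, ∑ j, α j + 1 ≤ m → WD d Ω i (E α) (E (α + Pi.single i 1)))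
    (hL : ∀ β γ : Fin d → ℕ, ∑ j, β j + ∑ j, γ j ≤ m → LocPair Ω (D β) (E γ)) (i : Fin d)
    (L : List ((Fin d → ℕ) × (Fin d → ℕ))) (h : ∀ b ∈ L, ∑ j, b.1 j + ∑ j, b.2 j + 1 ≤ m) :
    WD d Ω i (fun x => (L.map fun b => D b.1 x * E b.2 x).sum)
      (fun x => ((L.flatMap fun b => [(b.1 + Pi.single i 1, b.2), (b.1, b.2 + Pi.single i 1)]).map
        fun b => D b.1 x * E b.2 x).sum) := by
  induction L with
  | nil => exact WD.zero
  | cons b L ih =>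
    have hb := h b (by simp)
    have h1 := WD.mul hΩ (hD b.1 i (by omega)) (hE b.2 i (by omega)) (hL _ _ (by omega))
      (hL _ _ (by rw [sum_add_single]; omega)) (hL _ _ (by rw [sum_add_single]; omega))
    have h2 := h1.add (ih fun b' hb' => h b' (by simp [hb']))
    refine (congrArg₂ (WD d Ω i) ?_ ?_).mpr h2
    · rfl
    funext x
    rw [List.flatMap_cons, List.map_append, List.sum_append]
    simp only [List.map_cons, List.map_nil, List.sum_cons, List.sum_nil, add_zero]

lemma leib (d : ℕ) (n : ℕ) : ∀ α : Fin d → ℕ, ∑ j, α j = n →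
    ∃ L : List ((Fin d → ℕ) × (Fin d → ℕ)), (∀ b ∈ L, ∑ j, b.1 j + ∑ j, b.2 j = n) ∧
    ∀ (m : ℕ) (Ω : Set (Ed d)) (_ : IsOpen Ω) (D E : (Fin d → ℕ) → Ed d → ℝ) (w : Ed d → ℝ),
    (∀ α i, ∑ j, α j + 1 ≤ m → WD d Ω i (D α) (D (α + Pi.single i 1))) →
    (∀ α i, ∑ j, α j + 1 ≤ m → WD d Ω i (E α) (E (α + Pi.single i 1))) →
    (∀ β γ : Fin d → ℕ, ∑ j, β j + ∑ j, γ j ≤ m → LocPair Ω (D β) (E γ)) →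
    HasWeakDerivOn d Ω 0 w (fun x => D 0 x * E 0 x) → n ≤ m →
    HasWeakDerivOn d Ω α w (fun x => (L.map fun b => D b.1 x * E b.2 x).sum) := by
  induction n with
  | zero =>
    intro α hα
    have : α = 0 := by
      funext j
      simpa using (Finset.sum_eq_zero_iff.1 hα) j (Finset.mem_univ j)
    subst this
    refine ⟨[(0, 0)], by simp, fun m Ω hΩ D E w _ _ _ h0 _ => by simpa using h0⟩
  | succ n ih =>
    intro α hα
    obtain ⟨i, hi⟩ : ∃ i, α i ≠ 0 := by
      by_contra hcon
      push Not at hcon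
      simp [hcon] at hα
    have hα' : α = (α - Pi.single i 1) + Pi.single i 1 := by
      funext j
      by_cases hji : j = i
      · subst hji; simp; omega
      · simp [hji]
    generalize α - Pi.single i 1 = α' at hα'
    subst hα'
    rw [sum_add_single] at hα
    obtain ⟨L, hL1, hL2⟩ := ih α' (by omega)
    refine ⟨L.flatMap fun b => [(b.1 + Pi.single i 1, b.2), (b.1, b.2 + Pi.single i 1)], ?_, ?_⟩
    · intro b hb
      rw [List.mem_flatMap] at hb
      obtain ⟨c, hc, hb⟩ := hb
      have := hL1 c hc
      simp only [List.mem_cons, List.not_mem_nil, or_false] at hb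
      rcases hb with rfl | rfl
      · dsimp only; rw [sum_add_single]; omega
      · dsimp only; rw [sum_add_single]; omega
    · intro m Ω hΩ D E w hD hE hL h0 hn
      exact has_of_wd (hL2 m Ω hΩ D E w hD hE hL h0 (by omega))
        (wd_list hΩ hD hE hL i L fun b hb => by have := hL1 b hb; omega)

lemma rpow_comp {x y : ℝ} (hx : 0 < x) (hy : 0 < y) (h1 : x ≤ 2 * y) (h2 : y ≤ 2 * x) (t : ℝ) :
    x ^ t ≤ 2 ^ |t| * y ^ t := by
  rcases le_total 0 t with h | h
  · rw [abs_of_nonneg h, ← Real.mul_rpow (by norm_num) hy.le]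
    exact Real.rpow_le_rpow hx.le h1 h
  · have h3 : (2 * x) ^ t ≤ y ^ t := Real.rpow_le_rpow_of_nonpos hy h2 h
    rw [Real.mul_rpow (by norm_num) hx.le] at h3
    rw [abs_of_nonpos h, Real.rpow_neg (by norm_num), ← div_eq_inv_mul, le_div_iff₀ (by positivity)]
    linarith

lemma rho_nonneg {d ℓ : ℕ} (x : Ed d) : 0 ≤ rhoModel d ℓ x :=
  le_min zero_le_one (Real.sqrt_nonneg _)

lemma rho_pos {d ℓ : ℕ} {x : Ed d} (hx : x ∈ ModelDomain d ℓ) : 0 < rhoModel d ℓ x := by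
  have h := (tau_pos hx).trans_le (tau_le_rho x)
  exact lt_of_le_of_ne (rho_nonneg x) (fun h0 => by rw [← h0] at h; simp at h)

lemma rho_measurable (d ℓ : ℕ) : Measurable (rhoModel d ℓ) := by
  have h : Continuous (SA (AA d ℓ)) := (SA_contDiff (AA d ℓ)).continuous
  exact (continuous_const.min h.sqrt).measurable

lemma TT_rho {d ℓ : ℕ} {x : Ed d} (hx : x ∈ ModelDomain d ℓ) (s : ℝ) {B : ℝ} (hB : |s| ≤ B) :
    TT d ℓ s x ≤ 2 ^ B * rhoModel d ℓ x ^ s ∧ rhoModel d ℓ x ^ s ≤ 2 ^ B * TT d ℓ s x := by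
  have ht := tau_pos hx
  have hr := rho_pos hx
  have h1 := tau_le_rho (ℓ := ℓ) x
  have h2 := rho_le_tau (ℓ := ℓ) x
  have e : rhoModel d ℓ x ^ s = (rhoModel d ℓ x ^ 2) ^ (s / 2) := by
    rw [← Real.rpow_natCast, ← Real.rpow_mul hr.le]; congr 1; push_cast; ring
  have hr2 : 0 < rhoModel d ℓ x ^ 2 := by positivity
  have hb : (2:ℝ) ^ |s / 2| ≤ 2 ^ B := by
    apply Real.rpow_le_rpow_of_exponent_le (by norm_num)
    rw [abs_div, abs_two]
    have := abs_nonneg s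
    linarith
  rw [e]
  unfold TT
  constructor
  · refine (rpow_comp ht hr2 (by linarith) (by linarith) _).trans ?_
    gcongr
  · refine (rpow_comp hr2 ht (by linarith) (by linarith) _).trans ?_
    gcongr

/-- weighted function with the original weight -/
def RW (d ℓ : ℕ) (s : ℝ) (v : Ed d → ℝ) (x : Ed d) : ℝ := rhoModel d ℓ x ^ s * v x

lemma RW_comp {d ℓ : ℕ} (s : ℝ) {B : ℝ} (hB : |s| ≤ B) (v : Ed d → ℝ) (q : ℝ≥0∞) :
    eLpNorm (fun x => TT d ℓ s x * v x) q (muO d ℓ) ≤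
      ((2:ℝ) ^ B).toNNReal * eLpNorm (RW d ℓ s v) q (muO d ℓ) ∧
    eLpNorm (RW d ℓ s v) q (muO d ℓ) ≤
      ((2:ℝ) ^ B).toNNReal * eLpNorm (fun x => TT d ℓ s x * v x) q (muO d ℓ) := by
  have h2 : (0:ℝ) ≤ 2 ^ B := by positivity
  constructor
  all_goals
    refine eLpNorm_le_nnreal_smul_eLpNorm_of_ae_le_mul ?_ q
    filter_upwards [ae_mem_model d ℓ] with x hx
    rw [← NNReal.coe_le_coe]
    simp only [NNReal.coe_mul, coe_nnnorm, Real.coe_toNNReal _ h2, norm_mul, Real.norm_eq_abs, RW]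
    rw [abs_of_nonneg (TT_nonneg s x), abs_of_nonneg (Real.rpow_nonneg (rho_nonneg x) _), ← mul_assoc]
    gcongr
  · exact (TT_rho hx s hB).1
  · exact (TT_rho hx s hB).2

lemma k_enorm {d ℓ : ℕ} {a p : ℝ} (hp : 1 < p) (α : Fin d → ℕ) (v : Ed d → ℝ) (x : Ed d) :
    ENNReal.ofReal (kIntegrand d (rhoModel d ℓ) a p α v x) =
      ‖RW d ℓ (((∑ i, α i : ℕ) : ℝ) - a) v x‖ₑ ^ p := by
  unfold kIntegrand RW
  have h := Real.rpow_nonneg (rho_nonneg (ℓ := ℓ) x) (((∑ i, α i : ℕ) : ℝ) - a)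
  rw [← ENNReal.ofReal_rpow_of_nonneg (by positivity) (by linarith), Real.enorm_eq_ofReal_abs,
    abs_mul, abs_of_nonneg h]

lemma k_nonneg {d ℓ : ℕ} {a p : ℝ} (α : Fin d → ℕ) (v : Ed d → ℝ) (x : Ed d) :
    0 ≤ kIntegrand d (rhoModel d ℓ) a p α v x := by
  have h := Real.rpow_nonneg (rho_nonneg (ℓ := ℓ) x) (((∑ i, α i : ℕ) : ℝ) - a)
  unfold kIntegrand
  positivity

lemma k_int {d ℓ : ℕ} {a p : ℝ} (hp : 1 < p) (α : Fin d → ℕ) (v : Ed d → ℝ)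
    (hi : IntegrableOn (kIntegrand d (rhoModel d ℓ) a p α v) (ModelDomain d ℓ) volume) :
    ENNReal.ofReal (∫ x in ModelDomain d ℓ, kIntegrand d (rhoModel d ℓ) a p α v x) =
      ∫⁻ x, ‖RW d ℓ (((∑ i, α i : ℕ) : ℝ) - a) v x‖ₑ ^ p ∂(muO d ℓ) := by
  rw [ofReal_integral_eq_lintegral_ofReal hi (Eventually.of_forall fun x => k_nonneg α v x)]
  exact lintegral_congr fun x => k_enorm hp α v x

lemma mem_multiIdx {d m : ℕ} {α : Fin d → ℕ} : α ∈ multiIdx d m ↔ ∑ i, α i ≤ m := by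
  unfold multiIdx
  rw [Finset.mem_filter, Fintype.mem_piFinset]
  refine ⟨fun h => h.2, fun h => ⟨fun i => ?_, h⟩⟩
  have := Finset.single_le_sum (f := α) (fun _ _ => Nat.zero_le _) (Finset.mem_univ i)
  simp only [Finset.mem_range]; omega

lemma KnormP_nonneg {d ℓ m : ℕ} {a p : ℝ} (D : (Fin d → ℕ) → Ed d → ℝ) :
    0 ≤ KnormP d (ModelDomain d ℓ) (rhoModel d ℓ) m a p D :=
  Real.rpow_nonneg (Finset.sum_nonneg fun α _ => integral_nonneg fun x => k_nonneg α _ x) _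

lemma s_bound {m n : ℕ} (h : n ≤ m) (a : ℝ) : |(n : ℝ) - a| ≤ m + |a| := by
  refine (abs_sub _ _).trans ?_
  rw [Nat.abs_cast]
  have : (n : ℝ) ≤ m := by exact_mod_cast h
  linarith

lemma fam_of_data {d ℓ m : ℕ} {a p : ℝ} (hp : 1 < p) {u : Ed d → ℝ} {D : (Fin d → ℕ) → Ed d → ℝ}
    (h : KMemData d (ModelDomain d ℓ) (rhoModel d ℓ) m a p u D) :
    Fam d ℓ m a p D (((2:ℝ) ^ (m + |a|)).toNNReal *
      ENNReal.ofReal (KnormP d (ModelDomain d ℓ) (rhoModel d ℓ) m a p D)) := by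
  have hp0 : 0 < p := by linarith
  refine ⟨fun α hα => (h.1 α (mem_multiIdx.2 hα)).2.1, fun α i hα => ?_, fun α hα => ?_⟩
  · exact wd_of_has (h.1 α (mem_multiIdx.2 (by omega)))
      (h.1 _ (mem_multiIdx.2 (by rw [sum_add_single]; omega)))
  · refine (RW_comp _ (s_bound hα a) (D α) _).1.trans ?_
    gcongr
    have hi := h.2 α (mem_multiIdx.2 hα)
    rw [eLpNorm_eq_lintegral_rpow_enorm_toReal (by simpa using hp0) (by simp)]
    simp only [ENNReal.coe_toReal, Real.coe_toNNReal _ hp0.le]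
    rw [← k_int hp α (D α) hi,
      ENNReal.ofReal_rpow_of_nonneg (integral_nonneg fun x => k_nonneg α _ x) (by positivity)]
    apply ENNReal.ofReal_le_ofReal
    unfold KnormP
    apply Real.rpow_le_rpow (integral_nonneg fun x => k_nonneg α _ x) _ (by positivity)
    exact Finset.single_le_sum (f := fun α => ∫ x in ModelDomain d ℓ,
      kIntegrand d (rhoModel d ℓ) a p α (D α) x)
      (fun α _ => integral_nonneg fun x => k_nonneg α _ x) (mem_multiIdx.2 hα)

lemma k_of_bound {d ℓ m : ℕ} {a p : ℝ} (hp : 1 < p) {w : Ed d → ℝ} {α : Fin d → ℕ}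
    (hα : ∑ j, α j ≤ m) (hw : AEStronglyMeasurable w (muO d ℓ)) {Q : ℝ} (hQ : 0 ≤ Q)
    (hb : eLpNorm (fun x => TT d ℓ (((∑ j, α j : ℕ) : ℝ) - a) x * w x) p.toNNReal (muO d ℓ) ≤
      ENNReal.ofReal Q) :
    IntegrableOn (kIntegrand d (rhoModel d ℓ) a p α w) (ModelDomain d ℓ) volume ∧
    ∫ x in ModelDomain d ℓ, kIntegrand d (rhoModel d ℓ) a p α w x ≤ (2 ^ (m + |a|) * Q) ^ p := by
  have hp0 : 0 < p := by linarith
  have h2 : (0:ℝ) ≤ 2 ^ (m + |a|) := by positivity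
  have h1 : eLpNorm (RW d ℓ (((∑ j, α j : ℕ) : ℝ) - a) w) p.toNNReal (muO d ℓ) ≤
      ENNReal.ofReal (2 ^ (m + |a|) * Q) := by
    refine (RW_comp _ (s_bound hα a) w _).2.trans ?_
    rw [ENNReal.ofReal_mul h2]
    gcongr
    rfl
  have hm : AEStronglyMeasurable (RW d ℓ (((∑ j, α j : ℕ) : ℝ) - a) w) (muO d ℓ) :=
    ((rho_measurable d ℓ).pow_const _).aestronglyMeasurable.mul hw
  have hL : MemLp (RW d ℓ (((∑ j, α j : ℕ) : ℝ) - a) w) p.toNNReal (muO d ℓ) :=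
    ⟨hm, h1.trans_lt ENNReal.ofReal_lt_top⟩
  have hi : IntegrableOn (kIntegrand d (rhoModel d ℓ) a p α w) (ModelDomain d ℓ) volume := by
    have := hL.integrable_norm_rpow (by simpa using hp0) (by simp)
    refine this.congr (Eventually.of_forall fun x => ?_)
    simp only [ENNReal.coe_toReal, Real.coe_toNNReal _ hp0.le]
    unfold kIntegrand RW
    rw [norm_mul, Real.norm_eq_abs, Real.norm_eq_abs,
      abs_of_nonneg (Real.rpow_nonneg (rho_nonneg x) _)]
  refine ⟨hi, ?_⟩
  have h3 := lint_le (by simpa using hp0) h1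
  rw [Real.coe_toNNReal _ hp0.le, ← k_int hp α w hi, ENNReal.ofReal_rpow_of_nonneg (by positivity) hp0.le,
    ENNReal.ofReal_le_ofReal_iff (by positivity)] at h3
  exact h3

lemma prod_bound_unif (d ℓ m₀ m₁ : ℕ) (a₀ p : ℝ) (hp : 1 < p) (hd : 2 ≤ d) (hm : (m₀ : ℝ) < d / p)
    (hm₁ : (m₁ : ℝ) ≤ 2 * m₀ - d / p) :
    ∃ C : ℝ≥0, ∀ D E N M, Fam d ℓ m₀ a₀ p D N → Fam d ℓ m₀ a₀ p E M →
      ∀ (n : ℕ) (β γ : Fin d → ℕ), ∑ j, β j + ∑ j, γ j = n → n ≤ m₁ →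
      eLpNorm (fun x => TT d ℓ ((n : ℝ) - 2 * (a₀ - d / (2 * p))) x * (D β x * E γ x))
        p.toNNReal (muO d ℓ) ≤ C * N * M := by
  choose c hc using prod_bound d ℓ m₀ m₁ a₀ p hp hd hm hm₁
  let c' : ℕ → ℕ → ℝ≥0 := fun n k => if h : n + k ≤ m₁ then c n k h else 0
  refine ⟨∑ n ∈ Finset.range (m₁ + 1), ∑ k ∈ Finset.range (m₁ + 1), c' n k,
    fun D E N M hD hE n β γ hn hnm => ?_⟩
  subst hn
  refine (hc _ _ hnm D E N M hD hE β γ rfl rfl).trans ?_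
  gcongr
  have h1 : c _ _ hnm = c' (∑ j, β j) (∑ j, γ j) := by simp only [c', dif_pos hnm]
  rw [h1]
  refine le_trans ?_ (Finset.single_le_sum (f := fun n => ∑ k ∈ Finset.range (m₁ + 1), c' n k)
    (fun _ _ => by positivity) (a := ∑ j, β j) (by simp; omega))
  exact Finset.single_le_sum (f := fun k => c' (∑ j, β j) k)
    (fun _ _ => by positivity) (a := ∑ j, γ j) (by simp; omega)

lemma list_bound {d ℓ : ℕ} {s : ℝ} {q : ℝ≥0∞} (hq : 1 ≤ q) {D E : (Fin d → ℕ) → Ed d → ℝ} {X : ℝ≥0∞}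
    (L : List ((Fin d → ℕ) × (Fin d → ℕ)))
    (hmeas : ∀ b ∈ L, AEStronglyMeasurable (fun x => D b.1 x * E b.2 x) (muO d ℓ))
    (hb : ∀ b ∈ L, eLpNorm (fun x => TT d ℓ s x * (D b.1 x * E b.2 x)) q (muO d ℓ) ≤ X) :
    AEStronglyMeasurable (fun x => (L.map fun b => D b.1 x * E b.2 x).sum) (muO d ℓ) ∧
    eLpNorm (fun x => TT d ℓ s x * (L.map fun b => D b.1 x * E b.2 x).sum) q (muO d ℓ) ≤
      L.length * X := by
  induction L with
  | nil => simp [aestronglyMeasurable_const]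
  | cons b L ih =>
    obtain ⟨h1, h2⟩ := ih (fun b hb' => hmeas b (by simp [hb'])) (fun b hb' => hb b (by simp [hb']))
    have hm0 := hmeas b (by simp)
    have hT := (TT_measurable (d := d) (ℓ := ℓ) s).aestronglyMeasurable (μ := muO d ℓ)
    simp only [List.map_cons, List.sum_cons, mul_add]
    refine ⟨hm0.add h1, (eLpNorm_add_le (hT.mul hm0) (hT.mul h1) hq).trans ?_⟩
    rw [List.length_cons]
    push_cast
    refine (add_le_add (hb b (by simp)) h2).trans_eq ?_
    ring

lemma has_zero {d : ℕ} {Ω : Set (Ed d)} {u f : Ed d → ℝ} (hΩ : IsOpen Ω)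
    (hf : LocallyIntegrableOn f Ω volume) (h : ∀ᵐ x ∂(volume.restrict Ω), f x = u x) :
    HasWeakDerivOn d Ω 0 u f := by
  refine ⟨?_, hf, fun φ hφ => ?_⟩
  · rw [locallyIntegrableOn_iff hΩ.isLocallyClosed] at hf ⊢
    intro k hk hkc
    exact (hf k hk hkc).congr (ae_restrict_of_ae_restrict_of_subset hk h)
  · rw [pderivA_zero]
    simp only [Pi.zero_apply, Finset.sum_const_zero, pow_zero, one_mul]
    refine integral_congr_ae ?_
    filter_upwards [h] with x hx
    rw [hx]

/-- Theorem `mult111`: for `1 < p < ∞`, `d/(2p) ≤ m₀ < d/p`, `m₁ ≤ 2m₀ - d/p` and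
`a₁ = 2(a₀ - d/(2p))` there is a constant `c` with
`‖u·v|𝒦^{m₁}_{a₁,p}‖ ≤ c ‖u|𝒦^{m₀}_{a₀,p}‖ ‖v|𝒦^{m₀}_{a₀,p}‖` in the model case. -/
theorem statement13 (d ℓ m₀ m₁ : ℕ) (hd : 2 ≤ d) (hl : ℓ < d) (hm₀ : 1 ≤ m₀)
    (a₀ p : ℝ) (hp : 1 < p)
    (h1 : (d : ℝ) / (2 * p) ≤ m₀) (h2 : (m₀ : ℝ) < d / p)
    (h3 : (m₁ : ℝ) ≤ 2 * m₀ - d / p) :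
    ∃ c : ℝ, 0 < c ∧ ∀ u v : Ed d → ℝ,
      MemKM d ℓ m₀ a₀ p u → MemKM d ℓ m₀ a₀ p v →
      MemKM d ℓ m₁ (2 * (a₀ - d / (2 * p))) p (u * v) ∧
      KnormM d ℓ m₁ (2 * (a₀ - d / (2 * p))) p (u * v) ≤
        c * KnormM d ℓ m₀ a₀ p u * KnormM d ℓ m₀ a₀ p v := by
  have hp0 : 0 < p := by linarith
  obtain ⟨C, hC⟩ := prod_bound_unif d ℓ m₀ m₁ a₀ p hp hd h2 h3
  choose L hL1 hL2 using fun α : Fin d → ℕ => leib d (∑ j, α j) α rfl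
  set a₁ : ℝ := 2 * (a₀ - d / (2 * p)) with ha₁
  set Ω := ModelDomain d ℓ with hΩd
  have hΩ : IsOpen Ω := model_open d ℓ
  set Λ : ℕ := ∑ α ∈ multiIdx d m₁, (L α).length with hΛ
  set K : ℝ := 2 ^ (m₀ + |a₀|) with hK
  have hK0 : 0 ≤ K := by positivity
  set K₁ : ℝ := 2 ^ (m₁ + |a₁|) with hK₁
  have hK₁0 : 0 ≤ K₁ := by positivity
  set A : ℝ := ((multiIdx d m₁).card : ℝ) ^ (1 / p) with hA
  have hA0 : 0 ≤ A := by positivity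
  refine ⟨A * (K₁ * (Λ * C * K * K)) + 1, by positivity, fun u v hu hv => ?_⟩
  have hDu := Exists.choose_spec hu
  have hEv := Exists.choose_spec hv
  have nu : KnormM d ℓ m₀ a₀ p u = KnormP d Ω (rhoModel d ℓ) m₀ a₀ p hu.choose := dif_pos hu
  have nv : KnormM d ℓ m₀ a₀ p v = KnormP d Ω (rhoModel d ℓ) m₀ a₀ p hv.choose := dif_pos hv
  set D := hu.choose with hDdef
  set E := hv.choose with hEdef
  have fD := fam_of_data hp hDu
  have fE := fam_of_data hp hEv
  have nu0 := KnormP_nonneg (ℓ := ℓ) (m := m₀) (a := a₀) (p := p) D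
  have nv0 := KnormP_nonneg (ℓ := ℓ) (m := m₀) (a := a₀) (p := p) E
  rw [nu, nv]
  set U := KnormP d Ω (rhoModel d ℓ) m₀ a₀ p D with hU
  set V := KnormP d Ω (rhoModel d ℓ) m₀ a₀ p E with hV
  have hlt : m₁ < m₀ := by
    have : (m₁ : ℝ) < m₀ := by linarith
    exact_mod_cast this
  have fin : ∀ t : ℝ, (K.toNNReal : ℝ≥0∞) * ENNReal.ofReal t ≠ ⊤ := fun t => by finiteness
  have hLP : ∀ β γ : Fin d → ℕ, ∑ j, β j + ∑ j, γ j ≤ m₁ → LocPair Ω (D β) (E γ) :=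
    fun β γ h => fam_locPair hp hd h2 h3 (fin _) (fin _) fD fE β γ h
  have hz : ∀ w : Ed d → ℝ, LocallyIntegrableOn w Ω volume → HasWeakDerivOn d Ω 0 w w :=
    fun w hw => has_zero hΩ hw (Eventually.of_forall fun _ => rfl)
  have z0 : (0 : Fin d → ℕ) ∈ multiIdx d m₀ := mem_multiIdx.2 (by simp)
  have hDu0 := hDu.1 0 z0
  have hEv0 := hEv.1 0 z0
  have hw0 : HasWeakDerivOn d Ω 0 (u * v) (fun x => D 0 x * E 0 x) := by
    refine has_zero hΩ ((hLP 0 0 (by simp)).locallyIntegrableOn hΩ) ?_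
    filter_upwards [weak_unique hΩ hDu0 (hz u hDu0.1), weak_unique hΩ hEv0 (hz v hEv0.1)] with x h h'
    rw [Pi.mul_apply, h, h']
  let F : (Fin d → ℕ) → Ed d → ℝ := fun α x => ((L α).map fun b => D b.1 x * E b.2 x).sum
  have hF : ∀ α ∈ multiIdx d m₁, HasWeakDerivOn d Ω α (u * v) (F α) := by
    intro α hα
    exact hL2 α m₁ Ω hΩ D E (u * v) (fun α i h => fD.2.1 α i (by omega))
      (fun α i h => fE.2.1 α i (by omega)) hLP hw0 (mem_multiIdx.1 hα)
  set Q : ℝ := Λ * C * K * K * U * V with hQ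
  have hQ0 : 0 ≤ Q := by positivity
  have hk : ∀ α ∈ multiIdx d m₁,
      IntegrableOn (kIntegrand d (rhoModel d ℓ) a₁ p α (F α)) Ω volume ∧
      ∫ x in Ω, kIntegrand d (rhoModel d ℓ) a₁ p α (F α) x ≤ (K₁ * Q) ^ p := by
    intro α hα
    have hαm := mem_multiIdx.1 hα
    have hLb := list_bound (d := d) (ℓ := ℓ) (s := ((∑ j, α j : ℕ) : ℝ) - a₁) (q := p.toNNReal)
      (D := D) (E := E) (by
        rw [← ENNReal.coe_one, ENNReal.coe_le_coe, Real.one_le_toNNReal]; exact hp.le) (L α)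
      (fun b hb => by
        have := hL1 α b hb
        exact (fD.1 b.1 (by omega)).aestronglyMeasurable.mul
          (fE.1 b.2 (by omega)).aestronglyMeasurable)
      (fun b hb => hC D E _ _ fD fE _ b.1 b.2 (hL1 α b hb) hαm)
    refine k_of_bound hp hαm hLb.1 hQ0 (hLb.2.trans ?_)
    have hlen : (L α).length ≤ Λ :=
      Finset.single_le_sum (f := fun α => (L α).length) (fun _ _ => Nat.zero_le _) hα
    have e : ENNReal.ofReal Q = (Λ : ℝ≥0∞) * (C * (K.toNNReal * ENNReal.ofReal U) *
        (K.toNNReal * ENNReal.ofReal V)) := by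
      have e1 : (K.toNNReal : ℝ≥0∞) = ENNReal.ofReal K := rfl
      have e2 : (C : ℝ≥0∞) = ENNReal.ofReal C := (ENNReal.ofReal_coe_nnreal).symm
      have e3 : (Λ : ℝ≥0∞) = ENNReal.ofReal Λ := (ENNReal.ofReal_natCast Λ).symm
      rw [e1, e2, e3, ← ENNReal.ofReal_mul hK0, ← ENNReal.ofReal_mul hK0,
        ← ENNReal.ofReal_mul (by positivity), ← ENNReal.ofReal_mul (by positivity),
        ← ENNReal.ofReal_mul (by positivity)]
      congr 1
      rw [hQ]; ring
    rw [e]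
    gcongr
  have hmem : MemKM d ℓ m₁ a₁ p (u * v) := ⟨F, hF, fun α hα => (hk α hα).1⟩
  refine ⟨hmem, ?_⟩
  have hG := Exists.choose_spec hmem
  have nw : KnormM d ℓ m₁ a₁ p (u * v) = KnormP d Ω (rhoModel d ℓ) m₁ a₁ p hmem.choose := dif_pos hmem
  rw [nw]
  have hint : ∀ α ∈ multiIdx d m₁,
      ∫ x in Ω, kIntegrand d (rhoModel d ℓ) a₁ p α (hmem.choose α) x ≤ (K₁ * Q) ^ p := by
    intro α hα
    refine le_trans (le_of_eq ?_) (hk α hα).2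
    refine integral_congr_ae ?_
    filter_upwards [weak_unique hΩ (hG.1 α hα) (hF α hα)] with x hx
    unfold kIntegrand
    rw [hx]
  have hsum := Finset.sum_le_sum hint
  rw [Finset.sum_const, nsmul_eq_mul] at hsum
  calc KnormP d Ω (rhoModel d ℓ) m₁ a₁ p hmem.choose
      ≤ ((multiIdx d m₁).card * (K₁ * Q) ^ p) ^ (1 / p) := by
        unfold KnormP
        exact Real.rpow_le_rpow (Finset.sum_nonneg fun α _ => integral_nonneg fun x => k_nonneg α _ x)
          hsum (by positivity)
    _ = A * (K₁ * Q) := by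
        rw [Real.mul_rpow (by positivity) (by positivity), ← Real.rpow_mul (by positivity),
          mul_one_div_cancel hp0.ne', Real.rpow_one]
    _ = (A * (K₁ * (Λ * C * K * K))) * U * V := by rw [hQ]; ring
    _ ≤ (A * (K₁ * (Λ * C * K * K)) + 1) * U * V := by
        gcongr
        linarith

end
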